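/- arXiv:2101.08217 — 5 statements merged into one kernel-verified Lean document; each statement's English description precedes it below -/
import Mathlib

section
/- Let d > 1 be an integer and let F be the finite field with 2^d elements. For each n ∈ {0, 1, 2, 3, 5, 7, 9, 15, 27} there exists a nonzero homogeneous polynomial f of degree 3 in four variables over F defining a smooth cubic surface such that the set of lines on V(f) defined over F has exactly n elements. -/
open MvPolynomial

/-- The restriction of `f` to the line spanned by `v` and `w`:
the polynomial `f (s • v + t • w)` in the two variables `s, t`. -/
noncomputable def lineRestrict {k : Type*} [CommRing k] (f : MvPolynomial (Fin 4) k)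
    (v w : Fin 4 → k) : MvPolynomial (Fin 2) k :=
  aeval (fun i => C (v i) * X 0 + C (w i) * X 1) f

/-- `W` is a line on the cubic surface `V(f)` defined over `k`: a 2-dimensional
`k`-linear subspace of `k⁴` on which `f` vanishes identically as a polynomial. -/
def IsLineOn {k : Type*} [Field k] (f : MvPolynomial (Fin 4) k)
    (W : Submodule k (Fin 4 → k)) : Prop :=
  Module.finrank k W = 2 ∧
    ∃ v w : Fin 4 → k, Submodule.span k {v, w} = W ∧ lineRestrict f v w = 0

/-- `f` defines a smooth cubic surface over `k`: `f` is a nonzero homogeneous cubic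
and, over an algebraic closure, the only common zero of `f` and its partial
derivatives is the origin. -/
def IsSmoothCubic (k : Type*) [Field k] (f : MvPolynomial (Fin 4) k) : Prop :=
  f ≠ 0 ∧ f.IsHomogeneous 3 ∧
    ∀ x : Fin 4 → AlgebraicClosure k,
      (eval x (map (algebraMap k (AlgebraicClosure k)) f) = 0 ∧
        ∀ i : Fin 4, eval x (map (algebraMap k (AlgebraicClosure k)) (pderiv i f)) = 0) →
      x = 0

section VanishingOnLines

variable {k : Type*} [Field k]

lemma eval_lineRestrict (f : MvPolynomial (Fin 4) k) (v w : Fin 4 → k) (c : Fin 2 → k) :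
    eval c (lineRestrict f v w) = eval (c 0 • v + c 1 • w) f := by
  induction f using MvPolynomial.induction_on with
  | C a => simp [lineRestrict]
  | add p q hp hq => simp only [lineRestrict, map_add] at *; rw [hp, hq]
  | mul_X p i hp =>
    simp only [lineRestrict, map_mul] at *
    rw [hp]
    simp [mul_comm]

lemma isHomogeneous_lineRestrict {f : MvPolynomial (Fin 4) k} {n : ℕ} (hf : f.IsHomogeneous n)
    (v w : Fin 4 → k) : (lineRestrict f v w).IsHomogeneous n := by
  have h := hf.aeval (fun i => C (v i) * X 0 + C (w i) * X 1 : Fin 4 → MvPolynomial (Fin 2) k)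
    (n := 1) fun i => ((isHomogeneous_C_mul_X _ _).add (isHomogeneous_C_mul_X _ _))
  simpa [lineRestrict] using h

/-- Over a field with at least four elements, a line on a cubic surface is a two-dimensional
subspace at all of whose points the cubic form vanishes. -/
lemma isLineOn_iff_forall_eval_eq_zero [Finite k] (hk : 4 ≤ Nat.card k)
    {f : MvPolynomial (Fin 4) k} (hf : f.IsHomogeneous 3) (W : Submodule k (Fin 4 → k)) :
    IsLineOn f W ↔ Module.finrank k W = 2 ∧ ∀ x ∈ W, eval x f = 0 := by
  constructor
  · rintro ⟨h2, v, w, rfl, h0⟩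
    refine ⟨h2, fun x hx => ?_⟩
    obtain ⟨a, b, rfl⟩ := Submodule.mem_span_pair.mp hx
    have := eval_lineRestrict f v w ![a, b]
    simpa [h0] using this.symm
  · rintro ⟨h2, h0⟩
    refine ⟨h2, ?_⟩
    let b := Module.finBasisOfFinrankEq k W h2
    have hspan : Submodule.span k {(b 0 : Fin 4 → k), (b 1 : Fin 4 → k)} = W := by
      have := congrArg (Submodule.map W.subtype) b.span_eq
      rw [Submodule.map_span, Submodule.map_top, Submodule.range_subtype] at this
      refine Eq.trans (congrArg _ ?_) this
      ext x
      simp [Fin.exists_fin_two, eq_comm]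
    refine ⟨b 0, b 1, hspan, ?_⟩
    have := Fintype.ofFinite k
    refine eq_zero_of_eval_zero_at_prod_finset _ (fun _ => Finset.univ) (fun i => ?_) fun x _ => ?_
    · have h3 := (isHomogeneous_lineRestrict hf (b 0) (b 1)).totalDegree_le
      have h4 := degreeOf_le_totalDegree (lineRestrict f (b 0) (b 1)) i
      rw [Finset.card_univ, ← Nat.card_eq_fintype_card]
      omega
    · rw [eval_lineRestrict]
      exact h0 _ (W.add_mem (W.smul_mem _ (b 0).2) (W.smul_mem _ (b 1).2))

lemma isSmoothCubic_of_forall {f : MvPolynomial (Fin 4) k} (hf : f.IsHomogeneous 3)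
    (h : ∀ x : Fin 4 → AlgebraicClosure k,
      (∀ i, eval x (map (algebraMap k (AlgebraicClosure k)) (pderiv i f)) = 0) → x = 0) :
    IsSmoothCubic k f := by
  refine ⟨?_, hf, fun x hx => h x hx.2⟩
  rintro rfl
  simpa using congrFun (h (fun _ => 1) (by simp)) 0

lemma exists_ne_zero_ne_one [Finite k] (hk : 4 ≤ Nat.card k) : ∃ ω : k, ω ≠ 0 ∧ ω ≠ 1 := by
  classical
  have := Fintype.ofFinite k
  rw [Nat.card_eq_fintype_card, ← Finset.card_univ] at hk
  have h2 : (({0, 1} : Finset k)).card < (Finset.univ : Finset k).card :=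
    Finset.card_le_two.trans_lt (by omega)
  obtain ⟨ω, -, hω⟩ := Finset.exists_mem_notMem_of_card_lt_card h2
  exact ⟨ω, by simpa using hω⟩

end VanishingOnLines

section Planes

variable {k : Type*} [Field k]

lemma finrank_span_pair_eq_two {u v : Fin 4 → k}
    (h : ∀ s t : k, s • u + t • v = 0 → s = 0 ∧ t = 0) :
    Module.finrank k (Submodule.span k {u, v}) = 2 := by
  have h2 := finrank_span_eq_card (LinearIndependent.pair_iff.mpr h)
  rwa [Matrix.range_cons_cons_empty, Fintype.card_fin] at h2

lemma exists_span_pair_of_finrank_eq_two {W : Submodule k (Fin 4 → k)}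
    (hW : Module.finrank k W = 2) :
    ∃ u ∈ W, ∃ v ∈ W, ∀ s t : k, s • u + t • v = 0 → s = 0 ∧ t = 0 := by
  let b := Module.finBasisOfFinrankEq k W hW
  refine ⟨b 0, (b 0).2, b 1, (b 1).2, LinearIndependent.pair_iff.mp ?_⟩
  have := b.linearIndependent.map' W.subtype W.ker_subtype
  convert! this
  ext i
  fin_cases i <;> rfl

lemma span_pair_eq_of_mem {W : Submodule k (Fin 4 → k)} (hW : Module.finrank k W = 2)
    {u v : Fin 4 → k} (hu : u ∈ W) (hv : v ∈ W)
    (h : ∀ s t : k, s • u + t • v = 0 → s = 0 ∧ t = 0) : Submodule.span k {u, v} = W :=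
  Submodule.eq_of_le_of_finrank_eq (Submodule.span_le.mpr (by simp [Set.insert_subset_iff, hu, hv]))
    (by rw [finrank_span_pair_eq_two h, hW])

lemma exists_ne_zero_mem_of_finrank_eq_two {W : Submodule k (Fin 4 → k)}
    (hW : Module.finrank k W = 2) (i : Fin 4) : ∃ v ∈ W, v ≠ 0 ∧ v i = 0 := by
  obtain ⟨u, hu, v, hv, h⟩ := exists_span_pair_of_finrank_eq_two hW
  by_cases hui : u i = 0
  · refine ⟨u, hu, ?_, hui⟩
    rintro rfl
    simpa using h 1 0
  · refine ⟨v i • u + (-u i) • v, W.add_mem (W.smul_mem _ hu) (W.smul_mem _ hv), fun h0 => ?_, ?_⟩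
    · exact hui (by simpa using (h _ _ h0).2)
    · simp [mul_comm]

lemma exists_combination_eq_zero {a b c d : k} (h : a * d = b * c) :
    ∃ s t : k, (s ≠ 0 ∨ t ≠ 0) ∧ s * a + t * c = 0 ∧ s * b + t * d = 0 := by
  by_cases hc : c = 0
  · by_cases ha : a = 0
    · by_cases hd : d = 0
      · exact ⟨0, 1, by simp, by simp [hc], by simp [hd]⟩
      · exact ⟨-d, b, by simp [hd], by simp [ha, hc], by ring⟩
    · have hd : d = 0 := by simpa [hc, ha] using h
      exact ⟨0, 1, by simp, by simp [hc], by simp [hd]⟩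
  · exact ⟨-c, a, by simp [hc], by ring, by linear_combination h⟩

/-- The graph of a linear map expressing the last two coordinates through the first two. -/
def graphPlane (φ : Matrix (Fin 2) (Fin 2) k) : Submodule k (Fin 4 → k) :=
  Submodule.span k {![1, 0, φ 0 0, φ 1 0], ![0, 1, φ 0 1, φ 1 1]}

/-- The graph of a linear map expressing the first two coordinates through the last two. -/
def cographPlane (ψ : Matrix (Fin 2) (Fin 2) k) : Submodule k (Fin 4 → k) :=
  Submodule.span k {![ψ 0 0, ψ 1 0, 1, 0], ![ψ 0 1, ψ 1 1, 0, 1]}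

/-- The line joining a point of the line `x₂ = x₃ = 0` to a point of the line `x₀ = x₁ = 0`. -/
def joinPlane (p q : Fin 2 → k) : Submodule k (Fin 4 → k) :=
  Submodule.span k {![p 0, p 1, 0, 0], ![0, 0, q 0, q 1]}

lemma mem_graphPlane {φ : Matrix (Fin 2) (Fin 2) k} {v : Fin 4 → k} :
    v ∈ graphPlane φ ↔
      v 2 = φ 0 0 * v 0 + φ 0 1 * v 1 ∧ v 3 = φ 1 0 * v 0 + φ 1 1 * v 1 := by
  rw [graphPlane, Submodule.mem_span_pair]
  constructor
  · rintro ⟨a, b, rfl⟩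
    simp [mul_comm]
  · rintro ⟨h2, h3⟩
    refine ⟨v 0, v 1, ?_⟩
    ext i
    fin_cases i <;> simp [h2, h3, mul_comm]

lemma mem_cographPlane {ψ : Matrix (Fin 2) (Fin 2) k} {v : Fin 4 → k} :
    v ∈ cographPlane ψ ↔
      v 0 = ψ 0 0 * v 2 + ψ 0 1 * v 3 ∧ v 1 = ψ 1 0 * v 2 + ψ 1 1 * v 3 := by
  rw [cographPlane, Submodule.mem_span_pair]
  constructor
  · rintro ⟨a, b, rfl⟩
    simp [mul_comm]
  · rintro ⟨h2, h3⟩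
    refine ⟨v 2, v 3, ?_⟩
    ext i
    fin_cases i <;> simp [h2, h3, mul_comm]

lemma mem_joinPlane {p q : Fin 2 → k} {v : Fin 4 → k} :
    v ∈ joinPlane p q ↔ ∃ s t : k, ![s * p 0, s * p 1, t * q 0, t * q 1] = v := by
  simp [joinPlane, Submodule.mem_span_pair]

lemma finrank_graphPlane (φ : Matrix (Fin 2) (Fin 2) k) :
    Module.finrank k (graphPlane φ) = 2 :=
  finrank_span_pair_eq_two fun s t h =>
    ⟨by simpa using congrFun h 0, by simpa using congrFun h 1⟩

lemma finrank_cographPlane (ψ : Matrix (Fin 2) (Fin 2) k) :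
    Module.finrank k (cographPlane ψ) = 2 :=
  finrank_span_pair_eq_two fun s t h =>
    ⟨by simpa using congrFun h 2, by simpa using congrFun h 3⟩

lemma smul_add_smul_join_eq_zero {p q : Fin 2 → k} (hp : p ≠ 0) (hq : q ≠ 0) (s t : k)
    (h : s • ![p 0, p 1, 0, 0] + t • ![0, 0, q 0, q 1] = 0) : s = 0 ∧ t = 0 := by
  have h0 : s * p 0 = 0 := by simpa using congrFun h 0
  have h1 : s * p 1 = 0 := by simpa using congrFun h 1
  have h2 : t * q 0 = 0 := by simpa using congrFun h 2
  have h3 : t * q 1 = 0 := by simpa using congrFun h 3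
  constructor
  · by_contra hs
    refine hp (funext fun i => ?_)
    fin_cases i <;> simp_all
  · by_contra ht
    refine hq (funext fun i => ?_)
    fin_cases i <;> simp_all

lemma finrank_joinPlane {p q : Fin 2 → k} (hp : p ≠ 0) (hq : q ≠ 0) :
    Module.finrank k (joinPlane p q) = 2 :=
  finrank_span_pair_eq_two (smul_add_smul_join_eq_zero hp hq)

lemma graphPlane_injective : Function.Injective (graphPlane (k := k)) := by
  intro φ φ' h
  have h0 : ![1, 0, φ 0 0, φ 1 0] ∈ graphPlane φ' := h ▸ mem_graphPlane.mpr (by simp)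
  have h1 : ![0, 1, φ 0 1, φ 1 1] ∈ graphPlane φ' := h ▸ mem_graphPlane.mpr (by simp)
  rw [mem_graphPlane] at h0 h1
  ext i j
  fin_cases i <;> fin_cases j <;> simp_all

lemma cographPlane_injective : Function.Injective (cographPlane (k := k)) := by
  intro ψ ψ' h
  have h0 : ![ψ 0 0, ψ 1 0, 1, 0] ∈ cographPlane ψ' := h ▸ mem_cographPlane.mpr (by simp)
  have h1 : ![ψ 0 1, ψ 1 1, 0, 1] ∈ cographPlane ψ' := h ▸ mem_cographPlane.mpr (by simp)
  rw [mem_cographPlane] at h0 h1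
  ext i j
  fin_cases i <;> fin_cases j <;> simp_all

lemma graphPlane_ne_cographPlane (φ : Matrix (Fin 2) (Fin 2) k) {ψ : Matrix (Fin 2) (Fin 2) k}
    (hψ : ψ.det = 0) : graphPlane φ ≠ cographPlane ψ := by
  intro h
  rw [Matrix.det_fin_two, sub_eq_zero] at hψ
  obtain ⟨s, t, hst, h0, h1⟩ := exists_combination_eq_zero
    (a := ψ 0 0) (b := ψ 1 0) (c := ψ 0 1) (d := ψ 1 1) (by linear_combination hψ)
  have hm : ![0, 0, s, t] ∈ graphPlane φ := h ▸ mem_cographPlane.mpr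
    ⟨by simp; linear_combination -h0, by simp; linear_combination -h1⟩
  rw [mem_graphPlane] at hm
  simp at hm
  simp [hm] at hst

lemma graphPlane_ne_joinPlane (φ : Matrix (Fin 2) (Fin 2) k) (p : Fin 2 → k) {q : Fin 2 → k}
    (hq : q ≠ 0) : graphPlane φ ≠ joinPlane p q := by
  intro h
  have hm : ![0, 0, q 0, q 1] ∈ graphPlane φ := h ▸ mem_joinPlane.mpr ⟨0, 1, by simp⟩
  rw [mem_graphPlane] at hm
  refine hq (funext fun i => ?_)
  fin_cases i <;> simp_all

lemma cographPlane_ne_joinPlane (ψ : Matrix (Fin 2) (Fin 2) k) {p : Fin 2 → k} (q : Fin 2 → k)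
    (hp : p ≠ 0) : cographPlane ψ ≠ joinPlane p q := by
  intro h
  have hm : ![p 0, p 1, 0, 0] ∈ cographPlane ψ := h ▸ mem_joinPlane.mpr ⟨1, 0, by simp⟩
  rw [mem_cographPlane] at hm
  refine hp (funext fun i => ?_)
  fin_cases i <;> simp_all

lemma exists_joinPlane_eq {W : Submodule k (Fin 4 → k)} (hW : Module.finrank k W = 2)
    {u v : Fin 4 → k} (hu : u ∈ W) (hu0 : u ≠ 0) (hu2 : u 2 = 0) (hu3 : u 3 = 0)
    (hv : v ∈ W) (hv0 : v ≠ 0) (hv2 : v 0 = 0) (hv3 : v 1 = 0) :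
    ∃ p q : Fin 2 → k, p ≠ 0 ∧ q ≠ 0 ∧ joinPlane p q = W := by
  have eu : ![u 0, u 1, 0, 0] = u := by ext i; fin_cases i <;> simp [hu2, hu3]
  have ev : ![0, 0, v 2, v 3] = v := by ext i; fin_cases i <;> simp [hv2, hv3]
  have hp : ![u 0, u 1] ≠ 0 := fun h => hu0 <| by
    rw [← eu]
    simpa using h
  have hq : ![v 2, v 3] ≠ 0 := fun h => hv0 <| by
    rw [← ev]
    simpa using h
  exact ⟨_, _, hp, hq, span_pair_eq_of_mem hW (eu ▸ hu) (ev ▸ hv)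
    (smul_add_smul_join_eq_zero hp hq)⟩

lemma eq_graphPlane_or_cographPlane_or_joinPlane {W : Submodule k (Fin 4 → k)}
    (hW : Module.finrank k W = 2) :
    (∃ φ, graphPlane φ = W) ∨ (∃ ψ : Matrix (Fin 2) (Fin 2) k, ψ.det = 0 ∧ cographPlane ψ = W) ∨
      ∃ p q : Fin 2 → k, p ≠ 0 ∧ q ≠ 0 ∧ joinPlane p q = W := by
  obtain ⟨u, hu, v, hv, huv⟩ := exists_span_pair_of_finrank_eq_two hW
  have hcomb (s t : k) : s • u + t • v ∈ W := W.add_mem (W.smul_mem _ hu) (W.smul_mem _ hv)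
  by_cases hm : u 0 * v 1 - u 1 * v 0 = 0
  · by_cases hn : u 2 * v 3 - u 3 * v 2 = 0
    · obtain ⟨s, t, hst, h0, h1⟩ := exists_combination_eq_zero (sub_eq_zero.mp hm)
      obtain ⟨s', t', hst', h2, h3⟩ := exists_combination_eq_zero (sub_eq_zero.mp hn)
      have key (s t : k) (hst : s ≠ 0 ∨ t ≠ 0) : s • u + t • v ≠ 0 := fun h => by
        simp [huv s t h] at hst
      exact .inr (.inr (exists_joinPlane_eq hW (hcomb s' t') (key s' t' hst') h2 h3
        (hcomb s t) (key s t hst) h0 h1))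
    · obtain ⟨c, hc⟩ : ∃ c, c * (u 2 * v 3 - u 3 * v 2) = 1 := ⟨_, inv_mul_cancel₀ hn⟩
      refine .inr (.inl ⟨!![c * (v 3 * u 0 - u 3 * v 0), c * (u 2 * v 0 - v 2 * u 0);
        c * (v 3 * u 1 - u 3 * v 1), c * (u 2 * v 1 - v 2 * u 1)], ?_, ?_⟩)
      · rw [Matrix.det_fin_two]
        simp only [Matrix.of_apply, Matrix.cons_val]
        linear_combination c ^ 2 * (u 2 * v 3 - u 3 * v 2) * hm
      · refine Submodule.eq_of_le_of_finrank_eq (Submodule.span_le.mpr ?_)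
          (by rw [finrank_cographPlane, hW])
        rw [Set.insert_subset_iff, Set.singleton_subset_iff]
        constructor
        · convert! hcomb (c * v 3) (c * -u 3) using 1
          ext i; fin_cases i <;> simp <;> first | ring1 | linear_combination -hc
        · convert! hcomb (c * -v 2) (c * u 2) using 1
          ext i; fin_cases i <;> simp <;> first | ring1 | linear_combination -hc
  · obtain ⟨c, hc⟩ : ∃ c, c * (u 0 * v 1 - u 1 * v 0) = 1 := ⟨_, inv_mul_cancel₀ hm⟩
    refine .inl ⟨!![c * (v 1 * u 2 - u 1 * v 2), c * (u 0 * v 2 - v 0 * u 2);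
        c * (v 1 * u 3 - u 1 * v 3), c * (u 0 * v 3 - v 0 * u 3)], ?_⟩
    refine Submodule.eq_of_le_of_finrank_eq (Submodule.span_le.mpr ?_)
      (by rw [finrank_graphPlane, hW])
    rw [Set.insert_subset_iff, Set.singleton_subset_iff]
    constructor
    · convert! hcomb (c * v 1) (c * -u 1) using 1
      ext i; fin_cases i <;> simp <;> first | ring1 | linear_combination -hc
    · convert! hcomb (c * -v 0) (c * u 0) using 1
      ext i; fin_cases i <;> simp <;> first | ring1 | linear_combination -hc

end Planes

namespace Polynomial

variable {k : Type*} [Field k]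

/-- The factorisations `p * q` of `g`, viewed as a binary form of degree five, with `p` of degree
`j`: the form `p` is normalised to be monic as a polynomial, a drop of its degree below `j` being
a zero at infinity. -/
def factorPairs (g : k[X]) (j : ℕ) : Set (k[X] × k[X]) :=
  {q | q.1.Monic ∧ q.1 * q.2 = g ∧ q.1.natDegree ≤ j ∧ q.2.natDegree ≤ 5 - j}

lemma exists_mem_factorPairs {g p q : k[X]} {j : ℕ} (hp0 : p ≠ 0) (hg : p * q = g)
    (hp : p.natDegree ≤ j) (hq : q.natDegree ≤ 5 - j) :
    ∃ r ∈ factorPairs g j, ∃ c : k, c ≠ 0 ∧ p = C c * r.1 ∧ r.2 = C c * q := by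
  have hc : p.leadingCoeff ≠ 0 := leadingCoeff_ne_zero.mpr hp0
  have hcc : C p.leadingCoeff * C p.leadingCoeff⁻¹ = 1 := by
    rw [← C_mul, mul_inv_cancel₀ hc, C_1]
  refine ⟨(p * C p.leadingCoeff⁻¹, C p.leadingCoeff * q), ⟨?_, ?_, ?_, ?_⟩,
    p.leadingCoeff, hc, ?_, rfl⟩
  · exact monic_mul_leadingCoeff_inv hp0
  · linear_combination p * q * hcc + hg
  · rwa [natDegree_mul_C (inv_ne_zero hc)]
  · rwa [natDegree_C_mul hc]
  · linear_combination -p * hcc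

lemma eq_of_mem_factorPairs {g : k[X]} {j : ℕ} {q r : k[X] × k[X]}
    (hq : q ∈ factorPairs g j) (hr : r ∈ factorPairs g j) (h : q.1 = r.1) : q = r :=
  Prod.ext h <| mul_left_cancel₀ hq.1.ne_zero (by rw [hq.2.1, h, hr.2.1])

lemma coeff_eq_of_mem_factorPairs_one {g : k[X]} {q : k[X] × k[X]} (h : q ∈ factorPairs g 1) :
    g.coeff 0 = q.1.coeff 0 * q.2.coeff 0 ∧
    g.coeff 1 = q.1.coeff 1 * q.2.coeff 0 + q.1.coeff 0 * q.2.coeff 1 ∧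
    g.coeff 2 = q.1.coeff 1 * q.2.coeff 1 + q.1.coeff 0 * q.2.coeff 2 ∧
    g.coeff 3 = q.1.coeff 1 * q.2.coeff 2 + q.1.coeff 0 * q.2.coeff 3 ∧
    g.coeff 4 = q.1.coeff 1 * q.2.coeff 3 + q.1.coeff 0 * q.2.coeff 4 ∧
    g.coeff 5 = q.1.coeff 1 * q.2.coeff 4 := by
  obtain ⟨-, hg, h1, h2⟩ := h
  have e1 (n : ℕ) (hn : 1 < n) : q.1.coeff n = 0 := coeff_eq_zero_of_natDegree_lt (by omega)
  have e2 (n : ℕ) (hn : 4 < n) : q.2.coeff n = 0 := coeff_eq_zero_of_natDegree_lt (by omega)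
  rw [← hg]
  simp [coeff_mul, Finset.Nat.antidiagonal_succ, e1, e2, add_comm]

lemma coeff_eq_of_mem_factorPairs_two {g : k[X]} {q : k[X] × k[X]} (h : q ∈ factorPairs g 2) :
    g.coeff 0 = q.1.coeff 0 * q.2.coeff 0 ∧
    g.coeff 1 = q.1.coeff 1 * q.2.coeff 0 + q.1.coeff 0 * q.2.coeff 1 ∧
    g.coeff 2 = q.1.coeff 2 * q.2.coeff 0 + q.1.coeff 1 * q.2.coeff 1 +
      q.1.coeff 0 * q.2.coeff 2 ∧
    g.coeff 3 = q.1.coeff 2 * q.2.coeff 1 + q.1.coeff 1 * q.2.coeff 2 +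
      q.1.coeff 0 * q.2.coeff 3 ∧
    g.coeff 4 = q.1.coeff 2 * q.2.coeff 2 + q.1.coeff 1 * q.2.coeff 3 ∧
    g.coeff 5 = q.1.coeff 2 * q.2.coeff 3 := by
  obtain ⟨-, hg, h1, h2⟩ := h
  have e1 (n : ℕ) (hn : 2 < n) : q.1.coeff n = 0 := coeff_eq_zero_of_natDegree_lt (by omega)
  have e2 (n : ℕ) (hn : 3 < n) : q.2.coeff n = 0 := coeff_eq_zero_of_natDegree_lt (by omega)
  rw [← hg]
  refine ⟨?_, ?_, ?_, ?_, ?_, ?_⟩ <;>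
    simp [coeff_mul, Finset.Nat.antidiagonal_succ, e1, e2] <;> ring

lemma eq_sum_of_natDegree_le_five {g : k[X]} (hg : g.natDegree ≤ 5) :
    g = C (g.coeff 0) + C (g.coeff 1) * X + C (g.coeff 2) * X ^ 2 + C (g.coeff 3) * X ^ 3 +
      C (g.coeff 4) * X ^ 4 + C (g.coeff 5) * X ^ 5 := by
  conv_lhs => rw [g.as_sum_range_C_mul_X_pow' (n := 6) (by omega)]
  simp [Finset.sum_range_succ]

lemma exists_mem_factorPairs_one_of_coeff_eq {g : k[X]} (hg : g.natDegree ≤ 5)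
    {p0 p1 d0 d1 d2 d3 d4 : k} (hp : p0 ≠ 0 ∨ p1 ≠ 0)
    (h0 : g.coeff 0 = p0 * d0) (h1 : g.coeff 1 = p1 * d0 + p0 * d1)
    (h2 : g.coeff 2 = p1 * d1 + p0 * d2) (h3 : g.coeff 3 = p1 * d2 + p0 * d3)
    (h4 : g.coeff 4 = p1 * d3 + p0 * d4) (h5 : g.coeff 5 = p1 * d4) :
    ∃ r ∈ factorPairs g 1, ∃ c : k, c ≠ 0 ∧ p0 = c * r.1.coeff 0 ∧ p1 = c * r.1.coeff 1 := by
  have hc0 : (C p1 * X + C p0).coeff 0 = p0 := by simp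
  have hc1 : (C p1 * X + C p0).coeff 1 = p1 := by simp
  obtain ⟨r, hr, c, hc, e, -⟩ := exists_mem_factorPairs (g := g) (j := 1)
    (p := C p1 * X + C p0) (q := C d4 * X ^ 4 + C d3 * X ^ 3 + C d2 * X ^ 2 + C d1 * X + C d0)
    (fun h => by rw [h] at hc0 hc1; simp at hc0 hc1; simp [← hc0, ← hc1] at hp)
    (by rw [eq_sum_of_natDegree_le_five hg, h0, h1, h2, h3, h4, h5]; simp only [C_add, C_mul]; ring)
    (by compute_degree) (by compute_degree)
  refine ⟨r, hr, c, hc, ?_, ?_⟩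
  · rw [← coeff_C_mul, ← e, hc0]
  · rw [← coeff_C_mul, ← e, hc1]

lemma exists_mem_factorPairs_one [CharP k 2] {g : k[X]} (hg : g.natDegree ≤ 5) {p0 p1 : k}
    (hp : p0 ≠ 0 ∨ p1 ≠ 0)
    (h : g.coeff 5 * p0 ^ 5 + g.coeff 4 * p0 ^ 4 * p1 + g.coeff 3 * p0 ^ 3 * p1 ^ 2 +
      g.coeff 2 * p0 ^ 2 * p1 ^ 3 + g.coeff 1 * p0 * p1 ^ 4 + g.coeff 0 * p1 ^ 5 = 0) :
    ∃ r ∈ factorPairs g 1, ∃ c : k, c ≠ 0 ∧ p0 = c * r.1.coeff 0 ∧ p1 = c * r.1.coeff 1 := by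
  by_cases h1 : p1 = 0
  · have h0 : p0 ≠ 0 := by simpa [h1] using hp
    have h5 : g.coeff 5 = 0 := by simpa [h1, h0] using h
    refine exists_mem_factorPairs_one_of_coeff_eq hg hp (d0 := g.coeff 0 / p0)
      (d1 := g.coeff 1 / p0) (d2 := g.coeff 2 / p0) (d3 := g.coeff 3 / p0)
      (d4 := g.coeff 4 / p0) ?_ ?_ ?_ ?_ ?_ ?_ <;>
      field_simp <;> simp [h1, h5]
  · refine exists_mem_factorPairs_one_of_coeff_eq hg hp
      (d4 := g.coeff 5 / p1)
      (d3 := (g.coeff 4 * p1 + p0 * g.coeff 5) / p1 ^ 2)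
      (d2 := (g.coeff 3 * p1 ^ 2 + p0 * g.coeff 4 * p1 + p0 ^ 2 * g.coeff 5) / p1 ^ 3)
      (d1 := (g.coeff 2 * p1 ^ 3 + p0 * g.coeff 3 * p1 ^ 2 + p0 ^ 2 * g.coeff 4 * p1 +
        p0 ^ 3 * g.coeff 5) / p1 ^ 4)
      (d0 := (g.coeff 1 * p1 ^ 4 + p0 * g.coeff 2 * p1 ^ 3 + p0 ^ 2 * g.coeff 3 * p1 ^ 2 +
        p0 ^ 3 * g.coeff 4 * p1 + p0 ^ 4 * g.coeff 5) / p1 ^ 5) ?_ ?_ ?_ ?_ ?_ ?_ <;>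
      field_simp <;> grind

lemma exists_mem_factorPairs_two {g : k[X]} (hg : g.natDegree ≤ 5)
    {e0 e1 e2 c0 c1 c2 c3 : k} (he : e1 ≠ 0)
    (h0 : g.coeff 0 = e0 * c0) (h1 : g.coeff 1 = e1 * c0 + e0 * c1)
    (h2 : g.coeff 2 = e2 * c0 + e1 * c1 + e0 * c2) (h3 : g.coeff 3 = e2 * c1 + e1 * c2 + e0 * c3)
    (h4 : g.coeff 4 = e2 * c2 + e1 * c3) (h5 : g.coeff 5 = e2 * c3) :
    ∃ r ∈ factorPairs g 2, ∃ c : k, c ≠ 0 ∧ e1 = c * r.1.coeff 1 ∧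
      r.2.coeff 0 = c * c0 ∧ r.2.coeff 1 = c * c1 ∧ r.2.coeff 2 = c * c2 ∧
      r.2.coeff 3 = c * c3 := by
  have hc1 : (C e2 * X ^ 2 + C e1 * X + C e0).coeff 1 = e1 := by simp
  obtain ⟨r, hr, c, hc, e, e'⟩ := exists_mem_factorPairs (g := g) (j := 2)
    (p := C e2 * X ^ 2 + C e1 * X + C e0)
    (q := C c3 * X ^ 3 + C c2 * X ^ 2 + C c1 * X + C c0)
    (fun h => by rw [h] at hc1; exact he (by simpa using hc1.symm))
    (by rw [eq_sum_of_natDegree_le_five hg, h0, h1, h2, h3, h4, h5]; simp only [C_add, C_mul]; ring)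
    (by compute_degree) (by compute_degree)
  refine ⟨r, hr, c, hc, ?_, ?_, ?_, ?_, ?_⟩
  · rw [← coeff_C_mul, ← e, hc1]
  all_goals simp [e', coeff_X, coeff_C]

lemma coeff_of_mem_factorPairs_one {g : k[X]} {q : k[X] × k[X]} (h : q ∈ factorPairs g 1) :
    q.1.coeff 1 = 1 ∨ q.1.coeff 1 = 0 ∧ q.1.coeff 0 = 1 := by
  obtain ⟨hm, -, h1, -⟩ := h
  obtain h | h : q.1.natDegree = 0 ∨ q.1.natDegree = 1 := by omega
  · exact .inr ⟨coeff_eq_zero_of_natDegree_lt (by omega), by simpa [h] using hm.coeff_natDegree⟩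
  · exact .inl (by simpa [h] using hm.coeff_natDegree)

lemma coeff_of_mem_factorPairs_two {g : k[X]} {q : k[X] × k[X]} (h : q ∈ factorPairs g 2) :
    q.1.coeff 0 ≠ 0 ∨ q.1.coeff 1 ≠ 0 ∨ q.1.coeff 2 ≠ 0 := by
  obtain ⟨hm, -, h1, -⟩ := h
  have hc := hm.coeff_natDegree
  interval_cases h : q.1.natDegree <;> simp [hc]

lemma eq_of_mem_factorPairs_one {g : k[X]} {q r : k[X] × k[X]} (hq : q ∈ factorPairs g 1)
    (hr : r ∈ factorPairs g 1) (h0 : q.1.coeff 0 = r.1.coeff 0)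
    (h1 : q.1.coeff 1 = r.1.coeff 1) : q = r := by
  refine eq_of_mem_factorPairs hq hr ?_
  ext n
  obtain rfl | rfl | hn : n = 0 ∨ n = 1 ∨ 1 < n := by omega
  · exact h0
  · exact h1
  · rw [coeff_eq_zero_of_natDegree_lt (hq.2.2.1.trans_lt hn),
      coeff_eq_zero_of_natDegree_lt (hr.2.2.1.trans_lt hn)]

lemma eq_of_mem_factorPairs_of_proportional {g : k[X]} (hg : g ≠ 0) {q r : k[X] × k[X]}
    (hq : q ∈ factorPairs g 2) (hr : r ∈ factorPairs g 2) {c : k}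
    (h0 : r.2.coeff 0 = c * q.2.coeff 0) (h1 : r.2.coeff 1 = c * q.2.coeff 1)
    (h2 : r.2.coeff 2 = c * q.2.coeff 2) (h3 : r.2.coeff 3 = c * q.2.coeff 3) : q = r := by
  have h : r.2 = C c * q.2 := by
    ext n
    rw [coeff_C_mul]
    obtain rfl | rfl | rfl | rfl | hn : n = 0 ∨ n = 1 ∨ n = 2 ∨ n = 3 ∨ 5 - 2 < n := by omega
    · exact h0
    · exact h1
    · exact h2
    · exact h3
    · rw [coeff_eq_zero_of_natDegree_lt (hq.2.2.2.trans_lt hn),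
        coeff_eq_zero_of_natDegree_lt (hr.2.2.2.trans_lt hn), mul_zero]
  have hq2 : q.2 ≠ 0 := by
    rintro h
    exact hg (by rw [← hq.2.1, h, mul_zero])
  have h1 : q.1 = r.1 * C c := mul_right_cancel₀ hq2 (by rw [hq.2.1, ← hr.2.1, h]; ring)
  have hc : c = 1 := by
    have := congrArg leadingCoeff h1
    rw [leadingCoeff_mul, hq.1.leadingCoeff, hr.1.leadingCoeff, leadingCoeff_C, one_mul] at this
    exact this.symm
  exact eq_of_mem_factorPairs hq hr (by rw [h1, hc, C_1, mul_one])

end Polynomial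

section QuinticCubic

variable {k : Type*} [Field k]

lemma isHomogeneous_C_mul_X_mul_X_mul_X (a : k) (i j l : Fin 4) :
    (C a * (X i * X j * X l)).IsHomogeneous 3 := by
  have h := ((isHomogeneous_X k i).mul (isHomogeneous_X k j)).mul (isHomogeneous_X k l)
  simpa using (isHomogeneous_C (Fin 4) a).mul h

/-- A cubic containing the skew lines `x₀ = x₁ = 0` and `x₂ = x₃ = 0`, with coefficients taken
from a polynomial `g` of degree at most five. -/
noncomputable def quinticCubic (g : Polynomial k) : MvPolynomial (Fin 4) k :=
  C 1 * (X 0 * X 0 * X 3) + C 1 * (X 1 * X 1 * X 2) + C (g.coeff 5) * (X 0 * X 2 * X 2) +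
    C (g.coeff 3) * (X 0 * X 2 * X 3) + C (g.coeff 1) * (X 0 * X 3 * X 3) +
    C (g.coeff 4) * (X 1 * X 2 * X 2) + C (g.coeff 2) * (X 1 * X 2 * X 3) +
    C (g.coeff 0) * (X 1 * X 3 * X 3)

lemma isHomogeneous_quinticCubic (g : Polynomial k) : (quinticCubic g).IsHomogeneous 3 := by
  unfold quinticCubic
  refine .add (.add (.add (.add (.add (.add (.add ?_ ?_) ?_) ?_) ?_) ?_) ?_) ?_ <;>
    exact isHomogeneous_C_mul_X_mul_X_mul_X _ _ _ _

lemma eval_quinticCubic (g : Polynomial k) (v : Fin 4 → k) :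
    eval v (quinticCubic g) = v 0 ^ 2 * v 3 + v 1 ^ 2 * v 2 +
      v 0 * (g.coeff 5 * v 2 ^ 2 + g.coeff 3 * (v 2 * v 3) + g.coeff 1 * v 3 ^ 2) +
      v 1 * (g.coeff 4 * v 2 ^ 2 + g.coeff 2 * (v 2 * v 3) + g.coeff 0 * v 3 ^ 2) := by
  simp [quinticCubic]
  ring

/-- The derivative of a separable polynomial in characteristic two, written as a binary form in
the square of the variable, has no zero in common with the even part of the polynomial. -/
lemma eq_zero_of_even_odd_part_eq_zero {K : Type*} [Field K] [Algebra k K] [CharP K 2]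
    (hK : ∀ a : K, ∃ t, t ^ 2 = a) {g : Polynomial k} (hg : g.Separable)
    (h4 : 4 ≤ g.natDegree) (h5 : g.natDegree ≤ 5) {z w : K}
    (ha : algebraMap k K (g.coeff 5) * z ^ 2 + algebraMap k K (g.coeff 3) * (z * w) +
      algebraMap k K (g.coeff 1) * w ^ 2 = 0)
    (hb : algebraMap k K (g.coeff 4) * z ^ 2 + algebraMap k K (g.coeff 2) * (z * w) +
      algebraMap k K (g.coeff 0) * w ^ 2 = 0) : z = 0 ∧ w = 0 := by
  by_cases hw : w = 0
  · refine ⟨?_, hw⟩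
    by_contra hz
    have c5 : g.coeff 5 = 0 := by simpa [hw, hz] using ha
    have c4 : g.coeff 4 = 0 := by simpa [hw, hz] using hb
    have hlead : g.leadingCoeff = 0 := by
      obtain h | h : g.natDegree = 4 ∨ g.natDegree = 5 := by omega
      all_goals rw [Polynomial.leadingCoeff, h]; assumption
    rw [Polynomial.leadingCoeff_eq_zero] at hlead
    simp [hlead] at h4
  · obtain ⟨t, ht⟩ := hK (z / w)
    obtain rfl : z = t ^ 2 * w := by field_simp at ht; exact ht.symm
    have hw2 : w ^ 2 ≠ 0 := pow_ne_zero 2 hw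
    have ha' : algebraMap k K (g.coeff 5) * t ^ 4 + algebraMap k K (g.coeff 3) * t ^ 2 +
      algebraMap k K (g.coeff 1) = 0 := by
      refine (mul_eq_zero.mp ?_).resolve_right hw2
      linear_combination ha
    have hb' : algebraMap k K (g.coeff 4) * t ^ 4 + algebraMap k K (g.coeff 2) * t ^ 2 +
      algebraMap k K (g.coeff 0) = 0 := by
      refine (mul_eq_zero.mp ?_).resolve_right hw2
      linear_combination hb
    have hsum := Polynomial.eq_sum_of_natDegree_le_five h5
    refine absurd ?_ (hg.aeval_derivative_ne_zero (x := t) ?_)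
    · have e2 : algebraMap k K 2 = 2 := map_ofNat _ 2
      have e3 : algebraMap k K 3 = 3 := map_ofNat _ 3
      have e4 : algebraMap k K 4 = 4 := map_ofNat _ 4
      rw [hsum]
      simp
      grind
    · rw [hsum]
      simp
      grind

lemma isSmoothCubic_quinticCubic [CharP k 2] {g : Polynomial k} (hg : g.Separable)
    (h4 : 4 ≤ g.natDegree) (h5 : g.natDegree ≤ 5) : IsSmoothCubic k (quinticCubic g) := by
  refine isSmoothCubic_of_forall (isHomogeneous_quinticCubic g) fun x hx => ?_
  have := charP_of_injective_algebraMap (algebraMap k (AlgebraicClosure k)).injective 2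
  have h0 := hx 0
  have h1 := hx 1
  have h2 := hx 2
  have h3 := hx 3
  simp [quinticCubic, pderiv_X] at h0 h1 h2 h3
  obtain ⟨hz, hw⟩ := eq_zero_of_even_odd_part_eq_zero
    (fun a => IsAlgClosed.exists_pow_nat_eq a two_pos) hg h4 h5 (z := x 2) (w := x 3)
    (by grind) (by grind)
  have hx0 : x 0 = 0 := by grind
  have hx1 : x 1 = 0 := by grind
  ext i
  fin_cases i <;> simp [hz, hw, hx0, hx1]

end QuinticCubic

section GraphLines

variable {k : Type*} [Field k] [CharP k 2]

lemma binary_cubic_eq_zero_iff [Finite k] (hk : 4 ≤ Nat.card k) (a b c d : k) :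
    (∀ s t, a * s ^ 3 + b * (s ^ 2 * t) + c * (s * t ^ 2) + d * t ^ 3 = 0) ↔
      a = 0 ∧ b = 0 ∧ c = 0 ∧ d = 0 := by
  constructor
  · intro h
    obtain ⟨ω, h0, h1⟩ := exists_ne_zero_ne_one hk
    have ha : a = 0 := by simpa using h 1 0
    have hd : d = 0 := by simpa using h 0 1
    have hbc := h 1 1
    have hω := h 1 ω
    have h1' : ω + 1 ≠ 0 := by grind
    have hc : c = 0 := by
      refine (mul_eq_zero.mp ?_).resolve_right (mul_ne_zero h0 h1')
      grind
    grind
  · rintro ⟨rfl, rfl, rfl, rfl⟩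
    simp

lemma isLineOn_graphPlane_iff [Finite k] (hk : 4 ≤ Nat.card k) (g : Polynomial k)
    (φ : Matrix (Fin 2) (Fin 2) k) :
    IsLineOn (quinticCubic g) (graphPlane φ) ↔
      φ 1 0 + (g.coeff 5 * φ 0 0 ^ 2 + g.coeff 3 * (φ 0 0 * φ 1 0) + g.coeff 1 * φ 1 0 ^ 2) = 0 ∧
      φ 1 1 + g.coeff 3 * (φ 0 0 * φ 1 1 + φ 0 1 * φ 1 0) +
        (g.coeff 4 * φ 0 0 ^ 2 + g.coeff 2 * (φ 0 0 * φ 1 0) + g.coeff 0 * φ 1 0 ^ 2) = 0 ∧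
      φ 0 0 + g.coeff 2 * (φ 0 0 * φ 1 1 + φ 0 1 * φ 1 0) +
        (g.coeff 5 * φ 0 1 ^ 2 + g.coeff 3 * (φ 0 1 * φ 1 1) + g.coeff 1 * φ 1 1 ^ 2) = 0 ∧
      φ 0 1 + (g.coeff 4 * φ 0 1 ^ 2 + g.coeff 2 * (φ 0 1 * φ 1 1) + g.coeff 0 * φ 1 1 ^ 2) = 0 := by
  rw [isLineOn_iff_forall_eval_eq_zero hk (isHomogeneous_quinticCubic g), finrank_graphPlane,
    ← binary_cubic_eq_zero_iff hk]
  simp only [true_and, eval_quinticCubic]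
  constructor
  · intro h s t
    have := h ![s, t, φ 0 0 * s + φ 0 1 * t, φ 1 0 * s + φ 1 1 * t] (mem_graphPlane.mpr (by simp))
    simp only [Matrix.cons_val] at this
    grind
  · intro h v hv
    obtain ⟨h2, h3⟩ := mem_graphPlane.mp hv
    have := h (v 0) (v 1)
    grind

namespace Polynomial

/-- The value at the zero of `q.1` of the binary quartic form given by `q.2`. -/
def cofactorValue (q : k[X] × k[X]) : k :=
  q.2.coeff 4 * q.1.coeff 0 ^ 4 + q.2.coeff 3 * (q.1.coeff 0 ^ 3 * q.1.coeff 1) +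
    q.2.coeff 2 * (q.1.coeff 0 ^ 2 * q.1.coeff 1 ^ 2) +
    q.2.coeff 1 * (q.1.coeff 0 * q.1.coeff 1 ^ 3) + q.2.coeff 0 * q.1.coeff 1 ^ 4

variable {g : k[X]} (hg : g.Separable) (h4 : 4 ≤ g.natDegree) (h5 : g.natDegree ≤ 5)
include hg h4 h5

lemma cofactorValue_ne_zero [Finite k] {q : k[X] × k[X]} (hq : q ∈ factorPairs g 1) :
    cofactorValue q ≠ 0 := by
  intro h
  obtain ⟨g0, g1, g2, g3, g4, g5⟩ := coeff_eq_of_mem_factorPairs_one hq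
  have hK (a : k) : ∃ t, t ^ 2 = a := (frobeniusEquiv k 2).surjective a
  unfold cofactorValue at h
  have := eq_zero_of_even_odd_part_eq_zero hK hg h4 h5 (z := q.1.coeff 0 ^ 2)
    (w := q.1.coeff 1 ^ 2) (by simp only [Algebra.algebraMap_self, RingHom.id_apply]; grind)
    (by simp only [Algebra.algebraMap_self, RingHom.id_apply]; grind)
  obtain h1 | h1 := coeff_of_mem_factorPairs_one hq <;> simp [h1] at this

lemma resolvent_ne_zero [Finite k] {q : k[X] × k[X]} (hq : q ∈ factorPairs g 2) :
    q.1.coeff 1 * (q.2.coeff 1 * q.2.coeff 2 + q.2.coeff 0 * q.2.coeff 3) ≠ 0 := by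
  obtain ⟨g0, g1, g2, g3, g4, g5⟩ := coeff_eq_of_mem_factorPairs_two hq
  have hK (a : k) : ∃ t, t ^ 2 = a := (frobeniusEquiv k 2).surjective a
  have key (z w : k) := eq_zero_of_even_odd_part_eq_zero hK hg h4 h5 (z := z) (w := w)
  simp only [Algebra.algebraMap_self, RingHom.id_apply] at key
  refine mul_ne_zero (fun h => ?_) fun h => ?_
  · obtain ⟨h0, h2⟩ := key (q.1.coeff 0) (q.1.coeff 2) (by grind) (by grind)
    obtain h' | h' | h' := coeff_of_mem_factorPairs_two hq
    exacts [h' h0, h' h, h' h2]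
  · obtain ⟨s, t, hst, h0, h1⟩ := exists_combination_eq_zero (a := q.2.coeff 3)
      (b := q.2.coeff 2) (c := q.2.coeff 1) (d := q.2.coeff 0) (by grind)
    have := key s t (by grind) (by grind)
    simp [this] at hst

end Polynomial

end GraphLines

section GraphCount

variable {k : Type*} [Field k]

lemma exists_eq_mul_of_mul_eq_mul {a b c d : k} (h : a * d = b * c) :
    ∃ q0 q1 l0 l1, a = q0 * l0 ∧ b = q0 * l1 ∧ c = q1 * l0 ∧ d = q1 * l1 := by
  by_cases ha : a = 0
  · by_cases hb : b = 0
    · exact ⟨0, 1, c, d, by simp [ha, hb]⟩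
    · exact ⟨1, d / b, a, b, by simp, by simp, by field_simp; linear_combination -h, by field_simp⟩
  · exact ⟨1, c / a, a, b, by simp, by simp, by field_simp, by field_simp; linear_combination h⟩

/-- The matrix of rank one attached to a zero of a binary quintic form. -/
def zeroMatrix (q : Polynomial k × Polynomial k) : Matrix (Fin 2) (Fin 2) k :=
  (Polynomial.cofactorValue q)⁻¹ •
    !![q.1.coeff 1 * q.1.coeff 0 ^ 2, q.1.coeff 0 ^ 3;
      q.1.coeff 1 ^ 3, q.1.coeff 0 * q.1.coeff 1 ^ 2]

/-- The matrix of rank two attached to a quadratic factor of a binary quintic form. -/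
def quadraticFactorMatrix (q : Polynomial k × Polynomial k) : Matrix (Fin 2) (Fin 2) k :=
  (q.1.coeff 1 * (q.2.coeff 1 * q.2.coeff 2 + q.2.coeff 0 * q.2.coeff 3))⁻¹ •
    !![q.2.coeff 1, q.2.coeff 0; q.2.coeff 3, q.2.coeff 2]

lemma det_zeroMatrix (q : Polynomial k × Polynomial k) : (zeroMatrix q).det = 0 := by
  simp [zeroMatrix, Matrix.det_fin_two]
  ring

variable [CharP k 2] [Finite k] (hk : 4 ≤ Nat.card k) {g : Polynomial k} (hg : g.Separable)
  (h4 : 4 ≤ g.natDegree) (h5 : g.natDegree ≤ 5)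
include hg h4 h5

lemma zeroMatrix_ne_zero {q : Polynomial k × Polynomial k} (hq : q ∈ g.factorPairs 1) :
    zeroMatrix q ≠ 0 := by
  have hc := inv_ne_zero (Polynomial.cofactorValue_ne_zero hg h4 h5 hq)
  intro h
  have h01 := congrFun₂ h 0 1
  have h10 := congrFun₂ h 1 0
  simp [zeroMatrix, hc] at h01 h10
  obtain h1 | h1 := Polynomial.coeff_of_mem_factorPairs_one hq <;> simp_all

lemma det_quadraticFactorMatrix_ne_zero {q : Polynomial k × Polynomial k}
    (hq : q ∈ g.factorPairs 2) : (quadraticFactorMatrix q).det ≠ 0 := by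
  have hc := Polynomial.resolvent_ne_zero hg h4 h5 hq
  have hd := right_ne_zero_of_mul hc
  rw [quadraticFactorMatrix, Matrix.det_smul, Matrix.det_fin_two]
  refine mul_ne_zero (pow_ne_zero _ (inv_ne_zero hc)) ?_
  simp only [Matrix.of_apply, Matrix.cons_val]
  grind

lemma injOn_zeroMatrix : Set.InjOn zeroMatrix (g.factorPairs 1) := by
  intro q hq r hr h
  have hc := inv_ne_zero (Polynomial.cofactorValue_ne_zero hg h4 h5 hq)
  have hd := inv_ne_zero (Polynomial.cofactorValue_ne_zero hg h4 h5 hr)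
  have h00 := congrFun₂ h 0 0
  have h01 := congrFun₂ h 0 1
  have h10 := congrFun₂ h 1 0
  have h11 := congrFun₂ h 1 1
  simp only [zeroMatrix, Matrix.smul_apply, Matrix.of_apply, Matrix.cons_val, smul_eq_mul] at *
  generalize (Polynomial.cofactorValue q)⁻¹ = c at *
  generalize (Polynomial.cofactorValue r)⁻¹ = d at *
  obtain h1 | ⟨h1, h0⟩ := Polynomial.coeff_of_mem_factorPairs_one hq <;>
    obtain h1' | ⟨h1', h0'⟩ := Polynomial.coeff_of_mem_factorPairs_one hr <;>
    simp_all [Polynomial.eq_of_mem_factorPairs_one hq hr]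

lemma injOn_quadraticFactorMatrix :
    Set.InjOn quadraticFactorMatrix (g.factorPairs 2) := by
  intro q hq r hr h
  have hc := inv_ne_zero (Polynomial.resolvent_ne_zero hg h4 h5 hq)
  have hd := inv_ne_zero (Polynomial.resolvent_ne_zero hg h4 h5 hr)
  have h00 := congrFun₂ h 0 0
  have h01 := congrFun₂ h 0 1
  have h10 := congrFun₂ h 1 0
  have h11 := congrFun₂ h 1 1
  simp only [quadraticFactorMatrix, Matrix.smul_apply, Matrix.of_apply, Matrix.cons_val,
    smul_eq_mul] at *
  generalize (q.1.coeff 1 * _)⁻¹ = c at *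
  generalize (r.1.coeff 1 * _)⁻¹ = d at *
  refine Polynomial.eq_of_mem_factorPairs_of_proportional hg.ne_zero hq hr (c := c / d)
    ?_ ?_ ?_ ?_ <;> field_simp <;> grind

include hk

lemma isLineOn_graphPlane_zeroMatrix {q : Polynomial k × Polynomial k}
    (hq : q ∈ g.factorPairs 1) : IsLineOn (quinticCubic g) (graphPlane (zeroMatrix q)) := by
  obtain ⟨g0, g1, g2, g3, g4, g5⟩ := Polynomial.coeff_eq_of_mem_factorPairs_one hq
  have hc := mul_inv_cancel₀ (Polynomial.cofactorValue_ne_zero hg h4 h5 hq)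
  rw [isLineOn_graphPlane_iff hk]
  simp only [zeroMatrix, Matrix.smul_apply, Matrix.of_apply, Matrix.cons_val, smul_eq_mul]
  rw [g0, g1, g2, g3, g4, g5]
  generalize (Polynomial.cofactorValue q)⁻¹ = c at *
  unfold Polynomial.cofactorValue at hc
  refine ⟨?_, ?_, ?_, ?_⟩ <;> grind

lemma isLineOn_graphPlane_quadraticFactorMatrix {q : Polynomial k × Polynomial k}
    (hq : q ∈ g.factorPairs 2) :
    IsLineOn (quinticCubic g) (graphPlane (quadraticFactorMatrix q)) := by
  obtain ⟨g0, g1, g2, g3, g4, g5⟩ := Polynomial.coeff_eq_of_mem_factorPairs_two hq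
  have hc := mul_inv_cancel₀ (Polynomial.resolvent_ne_zero hg h4 h5 hq)
  rw [isLineOn_graphPlane_iff hk]
  simp only [quadraticFactorMatrix, Matrix.smul_apply, Matrix.of_apply, Matrix.cons_val,
    smul_eq_mul]
  rw [g0, g1, g2, g3, g4, g5]
  generalize (q.1.coeff 1 * _)⁻¹ = c at *
  refine ⟨?_, ?_, ?_, ?_⟩ <;> grind

omit hg h4 in
lemma exists_zeroMatrix_eq {φ : Matrix (Fin 2) (Fin 2) k} (hφ : φ ≠ 0) (hdet : φ.det = 0)
    (h : IsLineOn (quinticCubic g) (graphPlane φ)) : ∃ q ∈ g.factorPairs 1, zeroMatrix q = φ := by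
  obtain ⟨e0, e1, e2, e3⟩ := (isLineOn_graphPlane_iff hk g φ).mp h
  rw [Matrix.det_fin_two, sub_eq_zero] at hdet
  obtain ⟨q0, q1, l0, l1, h00, h01, h10, h11⟩ := exists_eq_mul_of_mul_eq_mul hdet
  have hl : l1 ≠ 0 ∨ l0 ≠ 0 := by
    by_contra! hl
    exact hφ (Matrix.ext fun i j => by fin_cases i <;> fin_cases j <;> simp [*])
  obtain ⟨a, ha⟩ : ∃ a, g.coeff 5 * q0 ^ 2 + g.coeff 3 * (q0 * q1) + g.coeff 1 * q1 ^ 2 = a :=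
    ⟨_, rfl⟩
  obtain ⟨b, hb⟩ : ∃ b, g.coeff 4 * q0 ^ 2 + g.coeff 2 * (q0 * q1) + g.coeff 0 * q1 ^ 2 = b :=
    ⟨_, rfl⟩
  simp only [h00, h01, h10, h11] at e0 e1 e2 e3
  obtain ⟨hq1, hq0, hab⟩ : q1 = a * l0 ∧ q0 = b * l1 ∧ a * l1 = b * l0 := by
    obtain hl | hl := hl
    · have i0 : q0 = b * l1 := mul_right_cancel₀ hl (by grind)
      have i1 : a * l1 = b * l0 := mul_right_cancel₀ hl (by grind)
      exact ⟨mul_right_cancel₀ hl (by grind), i0, i1⟩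
    · have i0 : q1 = a * l0 := mul_right_cancel₀ hl (by grind)
      have i1 : a * l1 = b * l0 := mul_right_cancel₀ hl (by grind)
      exact ⟨i0, mul_right_cancel₀ hl (by grind), i1⟩
  obtain ⟨m, rfl, rfl⟩ : ∃ m, a = m * l0 ∧ b = m * l1 := by
    obtain hl | hl := hl
    · exact ⟨b / l1, by field_simp; exact hab, by field_simp⟩
    · exact ⟨a / l0, by field_simp, by field_simp; exact hab.symm⟩
  have hm : m ≠ 0 := by
    rintro rfl
    exact hφ (Matrix.ext fun i j => by fin_cases i <;> fin_cases j <;> simp [*])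
  have ha' : m * (g.coeff 5 * l1 ^ 4 + g.coeff 3 * (l1 ^ 2 * l0 ^ 2) + g.coeff 1 * l0 ^ 4) = l0 :=
    mul_right_cancel₀ hm (by grind)
  have hb' : m * (g.coeff 4 * l1 ^ 4 + g.coeff 2 * (l1 ^ 2 * l0 ^ 2) + g.coeff 0 * l0 ^ 4) = l1 :=
    mul_right_cancel₀ hm (by grind)
  obtain ⟨r, hr, c, hc, rfl, rfl⟩ := Polynomial.exists_mem_factorPairs_one h5 hl
    (mul_left_cancel₀ hm (by grind))
  refine ⟨r, hr, ?_⟩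
  have hmc : (Polynomial.cofactorValue r)⁻¹ = m * c ^ 3 := by
    obtain ⟨g0, g1, g2, g3, g4, g5⟩ := Polynomial.coeff_eq_of_mem_factorPairs_one hr
    rw [inv_eq_iff_eq_inv]
    refine eq_inv_of_mul_eq_one_left (mul_left_cancel₀ hc ?_)
    unfold Polynomial.cofactorValue
    rw [g5, g3, g1] at ha'
    rw [g4, g2, g0] at hb'
    clear g0 g1 g2 g3 g4 g5 e0 e1 e2 e3 ha hb hab hq0 hq1 h00 h01 h10 h11 hl
    obtain h1 | ⟨h1, h0⟩ := Polynomial.coeff_of_mem_factorPairs_one hr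
    · simp only [h1] at ha' ⊢
      grind
    · simp only [h1, h0] at hb' ⊢
      grind
  ext i j
  fin_cases i <;> fin_cases j <;>
    simp [zeroMatrix, hmc, h00, h01, h10, h11, hq0, hq1] <;> ring

lemma exists_quadraticFactorMatrix_eq {φ : Matrix (Fin 2) (Fin 2) k} (hdet : φ.det ≠ 0)
    (h : IsLineOn (quinticCubic g) (graphPlane φ)) :
    ∃ q ∈ g.factorPairs 2, quadraticFactorMatrix q = φ := by
  obtain ⟨e0, e1, e2, e3⟩ := (isLineOn_graphPlane_iff hk g φ).mp h
  obtain ⟨D, hD⟩ : ∃ D, φ 0 0 * φ 1 1 + φ 0 1 * φ 1 0 = D := ⟨_, rfl⟩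
  obtain ⟨a, ha⟩ : ∃ a, g.coeff 5 * φ 0 1 ^ 2 + g.coeff 3 * (φ 0 1 * φ 1 1) +
    g.coeff 1 * φ 1 1 ^ 2 = a := ⟨_, rfl⟩
  obtain ⟨b, hb⟩ : ∃ b, g.coeff 4 * φ 0 0 ^ 2 + g.coeff 2 * (φ 0 0 * φ 1 0) +
    g.coeff 0 * φ 1 0 ^ 2 = b := ⟨_, rfl⟩
  rw [hb, hD] at e1
  rw [ha, hD] at e2
  have hD0 : D ≠ 0 := by
    rw [Matrix.det_fin_two] at hdet
    grind
  obtain ⟨i, hi⟩ : ∃ i, D * i = 1 := ⟨_, mul_inv_cancel₀ hD0⟩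
  have key {x y : k} (h : x * D ^ 2 = y) : x = y * i ^ 2 := by
    linear_combination i ^ 2 * h - x * (D * i + 1) * hi
  have k0 := key (x := g.coeff 0) (y := (b * φ 0 1 + a * φ 0 0) * φ 0 1) (by grind)
  have k1 := key (x := g.coeff 1) (y := D * φ 0 1 + (b * φ 0 1 + a * φ 0 0) * φ 0 0) (by grind)
  have k2 : g.coeff 2 = (φ 0 0 + a) * i := by grind
  have k3 : g.coeff 3 = (φ 1 1 + b) * i := by grind
  have k4 := key (x := g.coeff 4) (y := (b * φ 1 1 + a * φ 1 0) * φ 1 1 + D * φ 1 0) (by grind)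
  have k5 := key (x := g.coeff 5) (y := (b * φ 1 1 + a * φ 1 0) * φ 1 0) (by grind)
  clear e0 e1 e2 e3 ha hb
  obtain ⟨r, hr, c, hc, hc1, hd0, hd1, hd2, hd3⟩ := Polynomial.exists_mem_factorPairs_two h5
    (e0 := (b * φ 0 1 + a * φ 0 0) * i) (e1 := 1) (e2 := (b * φ 1 1 + a * φ 1 0) * i)
    (c0 := φ 0 1 * i) (c1 := φ 0 0 * i) (c2 := φ 1 1 * i) (c3 := φ 1 0 * i)
    one_ne_zero (by grind) (by grind) (by grind) (by grind) (by grind) (by grind)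
  refine ⟨r, hr, ?_⟩
  have hcoef : (r.1.coeff 1 * (r.2.coeff 1 * r.2.coeff 2 + r.2.coeff 0 * r.2.coeff 3))⁻¹ * (c * i) =
      1 := by
    rw [inv_mul_eq_one₀]
    · grind
    · exact Polynomial.resolvent_ne_zero hg h4 h5 hr
  ext i j
  fin_cases i <;> fin_cases j <;>
    simp only [quadraticFactorMatrix, Matrix.smul_apply, Matrix.of_apply, smul_eq_mul,
      Fin.zero_eta, Fin.mk_one, Matrix.cons_val] <;>
    grind

lemma encard_graphPlane_lines :
    {φ | IsLineOn (quinticCubic g) (graphPlane φ)}.encard =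
      1 + (g.factorPairs 1).encard + (g.factorPairs 2).encard := by
  have hset : {φ | IsLineOn (quinticCubic g) (graphPlane φ)} =
      {0} ∪ zeroMatrix '' g.factorPairs 1 ∪ quadraticFactorMatrix '' g.factorPairs 2 := by
    ext φ
    constructor
    · intro h
      by_cases hφ : φ = 0
      · exact .inl (.inl hφ)
      by_cases hdet : φ.det = 0
      · exact .inl (.inr (exists_zeroMatrix_eq hk h5 hφ hdet h))
      · exact .inr (exists_quadraticFactorMatrix_eq hk hg h4 h5 hdet h)
    · rintro ((rfl | ⟨q, hq, rfl⟩) | ⟨q, hq, rfl⟩)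
      · simp [isLineOn_graphPlane_iff hk]
      · exact isLineOn_graphPlane_zeroMatrix hk hg h4 h5 hq
      · exact isLineOn_graphPlane_quadraticFactorMatrix hk hg h4 h5 hq
  rw [hset, Set.encard_union_eq, Set.encard_union_eq, Set.encard_singleton,
    (injOn_zeroMatrix hg h4 h5).encard_image, (injOn_quadraticFactorMatrix hg h4 h5).encard_image]
  · rw [Set.disjoint_singleton_left]
    rintro ⟨q, hq, h⟩
    exact zeroMatrix_ne_zero hg h4 h5 hq h
  · rw [Set.disjoint_left]
    rintro φ (rfl | ⟨q, hq, rfl⟩) ⟨r, hr, h⟩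
    · exact det_quadraticFactorMatrix_ne_zero hg h4 h5 hr (by simp [h])
    · exact det_quadraticFactorMatrix_ne_zero hg h4 h5 hr (by rw [h, det_zeroMatrix])

end GraphCount

section CographCount

variable {k : Type*} [Field k]

/-- The matrix of rank at most one attached to a linear factor of a binary quintic form. -/
def linearFactorMatrix (q : Polynomial k × Polynomial k) : Matrix (Fin 2) (Fin 2) k :=
  !![q.1.coeff 0 * q.2.coeff 3, q.1.coeff 0 * q.2.coeff 1;
    q.1.coeff 1 * q.2.coeff 3, q.1.coeff 1 * q.2.coeff 1]

lemma det_linearFactorMatrix (q : Polynomial k × Polynomial k) :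
    (linearFactorMatrix q).det = 0 := by
  simp [linearFactorMatrix, Matrix.det_fin_two]
  ring

variable [CharP k 2]

lemma coeff_one_ne_zero_or_coeff_three_ne_zero {g : Polynomial k} (hg : g.Separable)
    (h4 : 4 ≤ g.natDegree) {q : Polynomial k × Polynomial k} (hq : q ∈ g.factorPairs 1) :
    q.2.coeff 1 ≠ 0 ∨ q.2.coeff 3 ≠ 0 := by
  by_contra! h
  obtain ⟨hm, hmul, h1, h2⟩ := hq
  have hsep : q.2.Separable := (hmul ▸ hg).of_mul_right
  have hder : Polynomial.derivative q.2 = 0 := by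
    ext n
    rw [Polynomial.coeff_derivative, Polynomial.coeff_zero, mul_eq_zero]
    obtain ⟨m, rfl | rfl⟩ := n.even_or_odd'
    · left
      obtain rfl | rfl | hm : m = 0 ∨ m = 1 ∨ 2 ≤ m := by omega
      · exact h.1
      · exact h.2
      · exact Polynomial.coeff_eq_zero_of_natDegree_lt (by omega)
    · right
      push_cast
      grind
  rw [Polynomial.separable_def, hder, isCoprime_zero_right] at hsep
  have h0 := Polynomial.natDegree_eq_zero_of_isUnit hsep
  have := Polynomial.natDegree_mul_le (p := q.1) (q := q.2)
  rw [hmul] at this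
  omega

variable [Finite k] (hk : 4 ≤ Nat.card k) {g : Polynomial k}

include hk in
lemma isLineOn_cographPlane_iff (ψ : Matrix (Fin 2) (Fin 2) k) :
    IsLineOn (quinticCubic g) (cographPlane ψ) ↔
      ψ 1 0 ^ 2 + ψ 0 0 * g.coeff 5 + ψ 1 0 * g.coeff 4 = 0 ∧
      ψ 0 0 ^ 2 + ψ 0 0 * g.coeff 3 + ψ 0 1 * g.coeff 5 + ψ 1 0 * g.coeff 2 +
        ψ 1 1 * g.coeff 4 = 0 ∧
      ψ 1 1 ^ 2 + ψ 0 0 * g.coeff 1 + ψ 0 1 * g.coeff 3 + ψ 1 0 * g.coeff 0 +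
        ψ 1 1 * g.coeff 2 = 0 ∧
      ψ 0 1 ^ 2 + ψ 0 1 * g.coeff 1 + ψ 1 1 * g.coeff 0 = 0 := by
  rw [isLineOn_iff_forall_eval_eq_zero hk (isHomogeneous_quinticCubic g), finrank_cographPlane,
    ← binary_cubic_eq_zero_iff hk]
  simp only [true_and, eval_quinticCubic]
  constructor
  · intro h s t
    have := h ![ψ 0 0 * s + ψ 0 1 * t, ψ 1 0 * s + ψ 1 1 * t, s, t] (mem_cographPlane.mpr (by simp))
    simp only [Matrix.cons_val] at this
    grind
  · intro h v hv
    obtain ⟨h0, h1⟩ := mem_cographPlane.mp hv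
    have := h (v 2) (v 3)
    grind

include hk in
lemma isLineOn_cographPlane_linearFactorMatrix {q : Polynomial k × Polynomial k}
    (hq : q ∈ g.factorPairs 1) :
    IsLineOn (quinticCubic g) (cographPlane (linearFactorMatrix q)) := by
  obtain ⟨g0, g1, g2, g3, g4, g5⟩ := Polynomial.coeff_eq_of_mem_factorPairs_one hq
  rw [isLineOn_cographPlane_iff hk]
  simp only [linearFactorMatrix, Matrix.of_apply, Matrix.cons_val]
  rw [g0, g1, g2, g3, g4, g5]
  refine ⟨?_, ?_, ?_, ?_⟩ <;> grind

include hk in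
lemma exists_linearFactorMatrix_eq (h5 : g.natDegree ≤ 5) {ψ : Matrix (Fin 2) (Fin 2) k}
    (hψ : ψ ≠ 0) (hdet : ψ.det = 0) (h : IsLineOn (quinticCubic g) (cographPlane ψ)) :
    ∃ q ∈ g.factorPairs 1, linearFactorMatrix q = ψ := by
  obtain ⟨e0, e1, e2, e3⟩ := (isLineOn_cographPlane_iff hk ψ).mp h
  rw [Matrix.det_fin_two, sub_eq_zero] at hdet
  obtain ⟨p0, p1, l0, l1, h00, h01, h10, h11⟩ := exists_eq_mul_of_mul_eq_mul hdet
  simp only [h00, h01, h10, h11] at e0 e1 e2 e3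
  have hl : l0 ≠ 0 ∨ l1 ≠ 0 := by
    by_contra! hl
    exact hψ (Matrix.ext fun i j => by fin_cases i <;> fin_cases j <;> simp [*])
  have hp : p0 ≠ 0 ∨ p1 ≠ 0 := by
    by_contra! hl
    exact hψ (Matrix.ext fun i j => by fin_cases i <;> fin_cases j <;> simp [*])
  obtain ⟨f0, f1, f2⟩ : l0 * p1 ^ 2 = p0 * g.coeff 5 + p1 * g.coeff 4 ∧
      l0 * p0 ^ 2 + l1 * p1 ^ 2 = p0 * g.coeff 3 + p1 * g.coeff 2 ∧
      l1 * p0 ^ 2 = p0 * g.coeff 1 + p1 * g.coeff 0 := by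
    obtain hl | hl := hl
    · have i0 : l0 * p1 ^ 2 = p0 * g.coeff 5 + p1 * g.coeff 4 := mul_left_cancel₀ hl (by grind)
      have i1 : l0 * p0 ^ 2 + l1 * p1 ^ 2 = p0 * g.coeff 3 + p1 * g.coeff 2 :=
        mul_left_cancel₀ hl (by grind)
      exact ⟨i0, i1, mul_left_cancel₀ hl (by grind)⟩
    · have i0 : l1 * p0 ^ 2 = p0 * g.coeff 1 + p1 * g.coeff 0 := mul_left_cancel₀ hl (by grind)
      have i1 : l0 * p0 ^ 2 + l1 * p1 ^ 2 = p0 * g.coeff 3 + p1 * g.coeff 2 :=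
        mul_left_cancel₀ hl (by grind)
      exact ⟨mul_left_cancel₀ hl (by grind), i1, i0⟩
  clear e0 e1 e2 e3
  obtain ⟨r, hr, c, hc, rfl, rfl⟩ := Polynomial.exists_mem_factorPairs_one h5 hp (by grind)
  obtain ⟨g0, g1, g2, g3, g4, g5⟩ := Polynomial.coeff_eq_of_mem_factorPairs_one hr
  refine ⟨r, hr, ?_⟩
  obtain ⟨hl0, hl1⟩ : c * l0 = r.2.coeff 3 ∧ c * l1 = r.2.coeff 1 := by
    rw [g5, g4] at f0
    rw [g3, g2] at f1
    rw [g1, g0] at f2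
    clear g0 g1 g2 g3 g4 g5 h00 h01 h10 h11 hp hl
    obtain h1 | ⟨h1, h0⟩ := Polynomial.coeff_of_mem_factorPairs_one hr
    · simp only [h1] at f0 f1
      have : c * l0 = r.2.coeff 3 := mul_left_cancel₀ hc (by grind)
      exact ⟨this, mul_left_cancel₀ hc (by grind)⟩
    · simp only [h1, h0] at f1 f2
      exact ⟨mul_left_cancel₀ hc (by grind), mul_left_cancel₀ hc (by grind)⟩
  ext i j
  fin_cases i <;> fin_cases j <;>
    simp [linearFactorMatrix, h00, h01, h10, h11, ← hl0, ← hl1] <;> ring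

variable (hg : g.Separable) (h4 : 4 ≤ g.natDegree)
include hg h4

omit [Finite k] in
lemma linearFactorMatrix_ne_zero {q : Polynomial k × Polynomial k} (hq : q ∈ g.factorPairs 1) :
    linearFactorMatrix q ≠ 0 := by
  intro h
  have h00 := congrFun₂ h 0 0
  have h01 := congrFun₂ h 0 1
  have h10 := congrFun₂ h 1 0
  have h11 := congrFun₂ h 1 1
  have hd := coeff_one_ne_zero_or_coeff_three_ne_zero hg h4 hq
  simp only [linearFactorMatrix, Matrix.of_apply, Matrix.cons_val, Matrix.zero_apply] at *
  obtain h1 | ⟨h1, h0⟩ := Polynomial.coeff_of_mem_factorPairs_one hq <;> simp_all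

omit [Finite k] in
lemma injOn_linearFactorMatrix : Set.InjOn linearFactorMatrix (g.factorPairs 1) := by
  intro q hq r hr h
  have hd := coeff_one_ne_zero_or_coeff_three_ne_zero hg h4 hq
  have hd' := coeff_one_ne_zero_or_coeff_three_ne_zero hg h4 hr
  have h00 := congrFun₂ h 0 0
  have h01 := congrFun₂ h 0 1
  have h10 := congrFun₂ h 1 0
  have h11 := congrFun₂ h 1 1
  simp only [linearFactorMatrix, Matrix.of_apply, Matrix.cons_val] at *
  clear h
  obtain h1 | ⟨h1, h0⟩ := Polynomial.coeff_of_mem_factorPairs_one hq <;>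
    obtain h1' | ⟨h1', h0'⟩ := Polynomial.coeff_of_mem_factorPairs_one hr <;>
    refine Polynomial.eq_of_mem_factorPairs_one hq hr ?_ ?_ <;> grind

include hk in
lemma encard_cographPlane_lines (h5 : g.natDegree ≤ 5) :
    {ψ : Matrix (Fin 2) (Fin 2) k | ψ.det = 0 ∧
      IsLineOn (quinticCubic g) (cographPlane ψ)}.encard = 1 + (g.factorPairs 1).encard := by
  have hset : {ψ : Matrix (Fin 2) (Fin 2) k | ψ.det = 0 ∧
      IsLineOn (quinticCubic g) (cographPlane ψ)} =
      {0} ∪ linearFactorMatrix '' g.factorPairs 1 := by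
    ext ψ
    constructor
    · rintro ⟨hdet, h⟩
      by_cases hψ : ψ = 0
      · exact .inl hψ
      · exact .inr (exists_linearFactorMatrix_eq hk h5 hψ hdet h)
    · rintro (rfl | ⟨q, hq, rfl⟩)
      · simp [isLineOn_cographPlane_iff hk]
      · exact ⟨det_linearFactorMatrix q, isLineOn_cographPlane_linearFactorMatrix hk hq⟩
  rw [hset, Set.encard_union_eq, Set.encard_singleton,
    (injOn_linearFactorMatrix hg h4).encard_image]
  rw [Set.disjoint_singleton_left]
  rintro ⟨q, hq, h⟩
  exact linearFactorMatrix_ne_zero hg h4 hq h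

end CographCount

section JoinCount

variable {k : Type*} [Field k]

lemma joinPlane_eq_of_proportional {p q p' q' : Fin 2 → k} {c d : k} (hc : c ≠ 0) (hd : d ≠ 0)
    (hp : p = c • p') (hq : q = d • q') : joinPlane p q = joinPlane p' q' := by
  ext v
  rw [mem_joinPlane, mem_joinPlane]
  constructor
  · rintro ⟨s, t, rfl⟩
    exact ⟨s * c, t * d, by simp [hp, hq, mul_assoc]⟩
  · rintro ⟨s, t, rfl⟩
    exact ⟨s / c, t / d, by subst hp hq; simp; field_simp; simp⟩

/-- The line joining the points attached to a linear factor of a binary quintic form. -/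
def linearFactorPlane (q : Polynomial k × Polynomial k) : Submodule k (Fin 4 → k) :=
  joinPlane ![q.1.coeff 0, q.1.coeff 1] ![q.1.coeff 0 ^ 2, q.1.coeff 1 ^ 2]

lemma injOn_linearFactorPlane (g : Polynomial k) :
    Set.InjOn linearFactorPlane (g.factorPairs 1) := by
  intro q hq r hr h
  have hm : ![q.1.coeff 0, q.1.coeff 1, 0, 0] ∈ linearFactorPlane r :=
    h ▸ mem_joinPlane.mpr ⟨1, 0, by simp⟩
  obtain ⟨s, t, hst⟩ := mem_joinPlane.mp hm
  have h0 := congrFun hst 0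
  have h1 := congrFun hst 1
  simp at h0 h1
  refine Polynomial.eq_of_mem_factorPairs_one hq hr ?_ ?_ <;>
  obtain h1 | ⟨h1, h0⟩ := Polynomial.coeff_of_mem_factorPairs_one hq <;>
    obtain h1' | ⟨h1', h0'⟩ := Polynomial.coeff_of_mem_factorPairs_one hr <;> grind

variable [CharP k 2] [Finite k] (hk : 4 ≤ Nat.card k) {g : Polynomial k}
include hk

lemma isLineOn_joinPlane_iff {p q : Fin 2 → k} (hp : p ≠ 0) (hq : q ≠ 0) :
    IsLineOn (quinticCubic g) (joinPlane p q) ↔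
      p 0 ^ 2 * q 1 + p 1 ^ 2 * q 0 = 0 ∧
      p 0 * (g.coeff 5 * q 0 ^ 2 + g.coeff 3 * (q 0 * q 1) + g.coeff 1 * q 1 ^ 2) +
        p 1 * (g.coeff 4 * q 0 ^ 2 + g.coeff 2 * (q 0 * q 1) + g.coeff 0 * q 1 ^ 2) = 0 := by
  have h := binary_cubic_eq_zero_iff hk 0 (p 0 ^ 2 * q 1 + p 1 ^ 2 * q 0)
    (p 0 * (g.coeff 5 * q 0 ^ 2 + g.coeff 3 * (q 0 * q 1) + g.coeff 1 * q 1 ^ 2) +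
        p 1 * (g.coeff 4 * q 0 ^ 2 + g.coeff 2 * (q 0 * q 1) + g.coeff 0 * q 1 ^ 2)) 0
  simp only [true_and, and_true] at h
  rw [isLineOn_iff_forall_eval_eq_zero hk (isHomogeneous_quinticCubic g), finrank_joinPlane hp hq,
    ← h]
  simp only [true_and, eval_quinticCubic]
  constructor
  · intro h s t
    have := h ![s * p 0, s * p 1, t * q 0, t * q 1] (mem_joinPlane.mpr ⟨s, t, rfl⟩)
    simp only [Matrix.cons_val] at this
    grind
  · intro h v hv
    obtain ⟨s, t, rfl⟩ := mem_joinPlane.mp hv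
    have := h s t
    simp only [Matrix.cons_val]
    grind

lemma setOf_joinPlane_lines_eq (h5 : g.natDegree ≤ 5) :
    {W | IsLineOn (quinticCubic g) W ∧ ∃ p q, p ≠ 0 ∧ q ≠ 0 ∧ joinPlane p q = W} =
      linearFactorPlane '' g.factorPairs 1 := by
  ext W
  constructor
  · rintro ⟨h, p, q, hp, hq, rfl⟩
    rw [isLineOn_joinPlane_iff hk hp hq] at h
    obtain ⟨e0, e1⟩ := h
    have hp' : p 0 ≠ 0 ∨ p 1 ≠ 0 := by
      by_contra! hp0
      exact hp (funext fun i => by fin_cases i <;> simp [hp0])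
    obtain ⟨m, h0, h1⟩ : ∃ m, q 0 = m * p 0 ^ 2 ∧ q 1 = m * p 1 ^ 2 := by
      obtain hl | hl := hp'
      · exact ⟨q 0 / p 0 ^ 2, by field_simp, by field_simp; grind⟩
      · exact ⟨q 1 / p 1 ^ 2, by field_simp; grind, by field_simp⟩
    have hm : m ≠ 0 := by
      rintro rfl
      exact hq (funext fun i => by fin_cases i <;> simp [h0, h1])
    rw [h0, h1] at e1
    obtain ⟨r, hr, c, hc, hc0, hc1⟩ := Polynomial.exists_mem_factorPairs_one h5 hp'
      (mul_left_cancel₀ (pow_ne_zero 2 hm) (by grind))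
    refine ⟨r, hr, (joinPlane_eq_of_proportional hc (d := m * c ^ 2)
      (mul_ne_zero hm (pow_ne_zero 2 hc)) ?_ ?_).symm⟩
    · ext i
      fin_cases i <;> simp [hc0, hc1]
    · ext i
      fin_cases i <;> simp [hc0, hc1, h0, h1] <;> ring
  · rintro ⟨r, hr, rfl⟩
    obtain ⟨g0, g1, g2, g3, g4, g5⟩ := Polynomial.coeff_eq_of_mem_factorPairs_one hr
    have hp : ![r.1.coeff 0, r.1.coeff 1] ≠ 0 := by
      obtain h1 | h1 := Polynomial.coeff_of_mem_factorPairs_one hr <;> simp [h1]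
    have hq : ![r.1.coeff 0 ^ 2, r.1.coeff 1 ^ 2] ≠ 0 := by
      obtain h1 | h1 := Polynomial.coeff_of_mem_factorPairs_one hr <;> simp [h1]
    refine ⟨?_, _, _, hp, hq, rfl⟩
    rw [linearFactorPlane, isLineOn_joinPlane_iff hk hp hq]
    simp only [Matrix.cons_val]
    rw [g0, g1, g2, g3, g4, g5]
    constructor <;> grind

theorem encard_lines_quinticCubic (hg : g.Separable) (h4 : 4 ≤ g.natDegree)
    (h5 : g.natDegree ≤ 5) :
    {W | IsLineOn (quinticCubic g) W}.encard =
      2 + 3 * (g.factorPairs 1).encard + (g.factorPairs 2).encard := by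
  have hset : {W | IsLineOn (quinticCubic g) W} =
      graphPlane '' {φ | IsLineOn (quinticCubic g) (graphPlane φ)} ∪
      cographPlane '' {ψ : Matrix (Fin 2) (Fin 2) k | ψ.det = 0 ∧
        IsLineOn (quinticCubic g) (cographPlane ψ)} ∪
      {W | IsLineOn (quinticCubic g) W ∧ ∃ p q, p ≠ 0 ∧ q ≠ 0 ∧ joinPlane p q = W} := by
    ext W
    constructor
    · intro h
      obtain ⟨φ, rfl⟩ | ⟨ψ, hψ, rfl⟩ | hW := eq_graphPlane_or_cographPlane_or_joinPlane h.1
      · exact .inl (.inl ⟨φ, h, rfl⟩)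
      · exact .inl (.inr ⟨ψ, ⟨hψ, h⟩, rfl⟩)
      · exact .inr ⟨h, hW⟩
    · rintro ((⟨φ, h, rfl⟩ | ⟨ψ, h, rfl⟩) | h)
      exacts [h, h.2, h.1]
  rw [hset, Set.encard_union_eq, Set.encard_union_eq, graphPlane_injective.encard_image,
    cographPlane_injective.encard_image, encard_graphPlane_lines hk hg h4 h5,
    encard_cographPlane_lines hk hg h4 h5, setOf_joinPlane_lines_eq hk h5,
    (injOn_linearFactorPlane g).encard_image]
  · ring
  · rw [Set.disjoint_left]
    rintro _ ⟨φ, -, rfl⟩ ⟨ψ, hψ, h⟩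
    exact graphPlane_ne_cographPlane φ hψ.1 h.symm
  · rw [Set.disjoint_left]
    rintro _ (⟨φ, -, rfl⟩ | ⟨ψ, -, rfl⟩) ⟨-, p, q, hp, hq, h⟩
    · exact graphPlane_ne_joinPlane φ p hq h.symm
    · exact cographPlane_ne_joinPlane ψ q hp h.symm

end JoinCount

section FewLines

variable {k : Type*} [Field k]

/-- The sum of a binary cubic form in `x₀, x₁` and the homogenisation in `x₂, x₃` of a monic
cubic polynomial. -/
noncomputable def splitCubic (p : Polynomial k) : MvPolynomial (Fin 4) k :=
  C 1 * (X 0 * X 0 * X 1) + C 1 * (X 0 * X 1 * X 1) + C 1 * (X 2 * X 2 * X 2) +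
    C (p.coeff 2) * (X 2 * X 2 * X 3) + C (p.coeff 1) * (X 2 * X 3 * X 3) +
    C (p.coeff 0) * (X 3 * X 3 * X 3)

lemma isHomogeneous_splitCubic (p : Polynomial k) : (splitCubic p).IsHomogeneous 3 := by
  unfold splitCubic
  refine .add (.add (.add (.add (.add ?_ ?_) ?_) ?_) ?_) ?_ <;>
    exact isHomogeneous_C_mul_X_mul_X_mul_X _ _ _ _

lemma eval_splitCubic (p : Polynomial k) (v : Fin 4 → k) :
    eval v (splitCubic p) = v 0 ^ 2 * v 1 + v 0 * v 1 ^ 2 + (v 2 ^ 3 +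
      p.coeff 2 * (v 2 ^ 2 * v 3) + p.coeff 1 * (v 2 * v 3 ^ 2) + p.coeff 0 * v 3 ^ 3) := by
  simp [splitCubic]
  ring

lemma eq_sum_of_monic_of_natDegree_eq_three {p : Polynomial k} (hp : p.Monic)
    (h3 : p.natDegree = 3) : p = Polynomial.C (p.coeff 0) + Polynomial.C (p.coeff 1) *
      Polynomial.X + Polynomial.C (p.coeff 2) * Polynomial.X ^ 2 + Polynomial.X ^ 3 := by
  have hc : p.coeff 3 = 1 := by simpa [h3] using hp.coeff_natDegree
  conv_lhs => rw [p.as_sum_range_C_mul_X_pow' (n := 4) (by omega)]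
  simp [Finset.sum_range_succ, hc]

lemma isSmoothCubic_splitCubic [CharP k 2] {p : Polynomial k} (hp : p.Monic)
    (h3 : p.natDegree = 3) (hsep : p.Separable) : IsSmoothCubic k (splitCubic p) := by
  refine isSmoothCubic_of_forall (isHomogeneous_splitCubic p) fun x hx => ?_
  have := charP_of_injective_algebraMap (algebraMap k (AlgebraicClosure k)).injective 2
  have h0 := hx 0
  have h1 := hx 1
  have h2 := hx 2
  have hx3 := hx 3
  simp [splitCubic, pderiv_X] at h0 h1 h2 hx3
  have hx0 : x 0 = 0 := by grind
  have hx1 : x 1 = 0 := by grind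
  have hw : x 3 = 0 := by
    by_contra hw
    have hz : x 2 = x 2 / x 3 * x 3 := by field_simp
    generalize x 2 / x 3 = t at hz
    rw [hz] at h2 hx3
    have e0 : t ^ 2 + algebraMap k (AlgebraicClosure k) (p.coeff 1) = 0 := by
      refine (mul_eq_zero.mp ?_).resolve_right (pow_ne_zero 2 hw)
      grind
    have e1 : algebraMap k (AlgebraicClosure k) (p.coeff 2) * t ^ 2 +
        algebraMap k (AlgebraicClosure k) (p.coeff 0) = 0 := by
      refine (mul_eq_zero.mp ?_).resolve_right (pow_ne_zero 2 hw)
      grind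
    have hsum := eq_sum_of_monic_of_natDegree_eq_three hp h3
    refine absurd ?_ (hsep.aeval_derivative_ne_zero (x := t) ?_)
    · have c2 : algebraMap k (AlgebraicClosure k) 2 = 2 := map_ofNat _ 2
      rw [hsum]
      simp
      grind
    · rw [hsum]
      simp
      grind
  have hz : x 2 = 0 := by grind
  ext i
  fin_cases i <;> simp [hz, hw, hx0, hx1]

lemma not_isLineOn_splitCubic [CharP k 2] [Finite k] (hk : 4 ≤ Nat.card k) {p : Polynomial k}
    (hp : p.Monic) (h3 : p.natDegree = 3) (hirr : Irreducible p)
    (W : Submodule k (Fin 4 → k)) : ¬ IsLineOn (splitCubic p) W := by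
  rw [isLineOn_iff_forall_eval_eq_zero hk (isHomogeneous_splitCubic p)]
  rintro ⟨hW, h⟩
  simp only [eval_splitCubic] at h
  have hB (z w : k) (hzw : z ^ 3 + p.coeff 2 * (z ^ 2 * w) + p.coeff 1 * (z * w ^ 2) +
      p.coeff 0 * w ^ 3 = 0) : z = 0 ∧ w = 0 := by
    have hw : w = 0 := by
      by_contra hw
      have hroot : p.IsRoot (z / w) := by
        rw [eq_sum_of_monic_of_natDegree_eq_three hp h3]
        simp
        field_simp
        linear_combination hzw
      have h1 : p.natDegree = 1 := Polynomial.natDegree_eq_of_degree_eq_some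
        (Polynomial.degree_eq_one_of_irreducible_of_root hirr hroot)
      omega
    exact ⟨by simpa [hw] using hzw, hw⟩
  obtain ⟨ω, hω0, hω1⟩ := exists_ne_zero_ne_one hk
  obtain ⟨u, hu, hu0, hu1⟩ := exists_ne_zero_mem_of_finrank_eq_two hW 1
  obtain ⟨v, hv, hv0, hv1⟩ := exists_ne_zero_mem_of_finrank_eq_two hW 0
  obtain ⟨hu2, hu3⟩ := hB (u 2) (u 3) (by simpa [hu1] using h u hu)
  obtain ⟨hv2, hv3⟩ := hB (v 2) (v 3) (by simpa [hv1] using h v hv)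
  have hu' : u 0 ≠ 0 := fun h0 => hu0 <| by
    ext i
    fin_cases i <;> simp [h0, hu1, hu2, hu3]
  have hv' : v 1 ≠ 0 := fun h0 => hv0 <| by
    ext i
    fin_cases i <;> simp [h0, hv1, hv2, hv3]
  have e1 := h _ (W.add_mem hu hv)
  have e2 := h _ (W.add_mem hu (W.smul_mem ω hv))
  simp only [Pi.add_apply, Pi.smul_apply, smul_eq_mul, hu1, hu2, hu3, hv1, hv2, hv3] at e1 e2
  have e3 : u 0 * v 1 * (u 0 + v 1) = 0 := by linear_combination e1
  have e4 : u 0 * v 1 * ω * (u 0 + ω * v 1) = 0 := by linear_combination e2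
  have e5 : u 0 + v 1 = 0 := (mul_eq_zero.mp e3).resolve_left (mul_ne_zero hu' hv')
  have e6 : u 0 + ω * v 1 = 0 :=
    (mul_eq_zero.mp e4).resolve_left (mul_ne_zero (mul_ne_zero hu' hv') hω0)
  exact hω1 (mul_right_cancel₀ hv' (by linear_combination e6 - e5))

/-- A cubic surface with a single line when `ν` is not of the form `t ^ 2 + t`. -/
noncomputable def oneLineCubic (ν : k) : MvPolynomial (Fin 4) k :=
  C 1 * (X 1 * X 2 * X 2) + C 1 * (X 1 * X 2 * X 3) + C ν * (X 1 * X 3 * X 3) +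
    C ν * (X 0 * X 2 * X 2) + C 1 * (X 0 * X 0 * X 3) + C 1 * (X 0 * X 1 * X 1)

lemma isHomogeneous_oneLineCubic (ν : k) : (oneLineCubic ν).IsHomogeneous 3 := by
  unfold oneLineCubic
  refine .add (.add (.add (.add (.add ?_ ?_) ?_) ?_) ?_) ?_ <;>
    exact isHomogeneous_C_mul_X_mul_X_mul_X _ _ _ _

lemma eval_oneLineCubic (ν : k) (v : Fin 4 → k) :
    eval v (oneLineCubic ν) = v 1 * (v 2 ^ 2 + v 2 * v 3 + ν * v 3 ^ 2) + ν * v 0 * v 2 ^ 2 +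
      v 0 ^ 2 * v 3 + v 0 * v 1 ^ 2 := by
  simp [oneLineCubic]
  ring

lemma isSmoothCubic_oneLineCubic [CharP k 2] {ν : k} (hν : ν ≠ 0) :
    IsSmoothCubic k (oneLineCubic ν) := by
  refine isSmoothCubic_of_forall (isHomogeneous_oneLineCubic ν) fun x hx => ?_
  have := charP_of_injective_algebraMap (algebraMap k (AlgebraicClosure k)).injective 2
  have hν' : algebraMap k (AlgebraicClosure k) ν ≠ 0 := by simpa using hν
  have h0 := hx 0
  have h1 := hx 1
  have h2 := hx 2
  have h3 := hx 3
  simp [oneLineCubic, pderiv_X] at h0 h1 h2 h3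
  have e2 : x 1 * x 3 = 0 := by grind
  have hx1 : x 1 = 0 := by
    obtain h | h := mul_eq_zero.mp e2
    · exact h
    · have : x 2 = 0 := by grind
      grind
  have hx2 : x 2 = 0 := by grind
  have hx3 : x 3 = 0 := by grind
  have hx0 : x 0 = 0 := by grind
  ext i
  fin_cases i <;> simp [hx0, hx1, hx2, hx3]

lemma isLineOn_oneLineCubic_iff [CharP k 2] [Finite k] (hk : 4 ≤ Nat.card k) {ν : k}
    (hν : ∀ t, t ^ 2 + t ≠ ν) (W : Submodule k (Fin 4 → k)) :
    IsLineOn (oneLineCubic ν) W ↔ W = cographPlane 0 := by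
  rw [isLineOn_iff_forall_eval_eq_zero hk (isHomogeneous_oneLineCubic ν)]
  simp only [eval_oneLineCubic]
  constructor
  · rintro ⟨hW, h⟩
    have hQ (z w : k) (hzw : z ^ 2 + z * w + ν * w ^ 2 = 0) : z = 0 ∧ w = 0 := by
      have hw : w = 0 := by
        by_contra hw
        refine hν (z / w) ?_
        field_simp
        grind
      exact ⟨by simpa [hw] using hzw, hw⟩
    obtain ⟨ω, hω0, hω1⟩ := exists_ne_zero_ne_one hk
    have hcoef (u v : Fin 4 → k) (hu : u ∈ W) (hv : v ∈ W) (s : k) :=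
      h _ (W.add_mem hu (W.smul_mem s hv))
    simp only [Pi.add_apply, Pi.smul_apply, smul_eq_mul] at hcoef
    have hfst (v : Fin 4 → k) (hv : v ∈ W) (hv0 : v 0 = 0) : v 1 = 0 := by
      by_contra hv1
      obtain ⟨hv2, hv3⟩ := hQ (v 2) (v 3) (by simpa [hv0, hv1] using h v hv)
      obtain ⟨u, hu, hu0, hu1⟩ := exists_ne_zero_mem_of_finrank_eq_two hW 1
      have e0 := h u hu
      have e1 := hcoef u v hu hv 1
      have e2 := hcoef u v hu hv ω
      simp only [hu1, hv0, hv2, hv3] at e0 e1 e2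
      have e3 : u 0 * v 1 ^ 2 * (ω * (ω - 1)) = 0 := by
        linear_combination e2 - ω * e1 + (ω - 1) * e0
      have hu0' : u 0 = 0 := by
        simpa [hv1, hω0, sub_eq_zero, hω1] using e3
      have e4 : v 1 * (u 2 ^ 2 + u 2 * u 3 + ν * u 3 ^ 2) = 0 := by
        rw [hu0'] at e1
        linear_combination e1
      obtain ⟨hu2, hu3⟩ := hQ _ _ ((mul_eq_zero.mp e4).resolve_left hv1)
      refine hu0 (funext fun i => ?_)
      fin_cases i <;> simp [hu0', hu1, hu2, hu3]
    by_cases hall : ∀ v ∈ W, v 0 = 0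
    · refine Submodule.eq_of_le_of_finrank_eq (fun v hv => ?_) (by rw [hW, finrank_cographPlane])
      simp [mem_cographPlane, hall v hv, hfst v hv (hall v hv)]
    · push Not at hall
      obtain ⟨u, hu, hu0⟩ := hall
      obtain ⟨v, hv, hv0, hv1⟩ := exists_ne_zero_mem_of_finrank_eq_two hW 0
      have hv2 := hfst v hv hv1
      have e0 := h u hu
      have e1 := hcoef u v hu hv 1
      have e2 := hcoef u v hu hv ω
      simp only [hv1, hv2] at e0 e1 e2
      have e3 : (u 1 * (v 2 ^ 2 + v 2 * v 3 + ν * v 3 ^ 2) + ν * u 0 * v 2 ^ 2) *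
          (ω * (ω - 1)) = 0 := by
        linear_combination e2 - ω * e1 + (ω - 1) * e0
      have e4 : u 1 * (v 2 ^ 2 + v 2 * v 3 + ν * v 3 ^ 2) + ν * u 0 * v 2 ^ 2 = 0 := by
        simpa [hω0, sub_eq_zero, hω1] using e3
      have e5 : u 1 * (u 2 * v 3 + u 3 * v 2) + u 0 ^ 2 * v 3 = 0 := by
        have := CharTwo.two_eq_zero (R := k)
        linear_combination (exp := 1) e1 - e0 - e4 - (u 1 * u 2 * v 2 + u 1 * ν * u 3 * v 3 + ν * u 0 * u 2 * v 2) * this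
      have hν0 : ν ≠ 0 := fun h0 => hν 0 (by simp [h0])
      have hv3 : v 3 ≠ 0 := by
        intro hv3
        have hv2' : v 2 ≠ 0 := fun h2 => hv0 <| by
          ext i
          fin_cases i <;> simp [hv1, hv2, h2, hv3]
        have hu1 : u 1 + ν * u 0 = 0 := by
          refine (mul_eq_zero.mp ?_).resolve_right (pow_ne_zero 2 hv2')
          rw [hv3] at e4
          linear_combination e4
        have hu1' : u 1 ≠ 0 := fun h1 => mul_ne_zero hν0 hu0 (by simpa [h1] using hu1)
        have hu3 : u 3 = 0 := by simpa [hv3, hv2', hu1'] using e5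
        rw [hu3] at e0
        have : u 0 * u 1 ^ 2 = 0 := by linear_combination e0 - u 2 ^ 2 * hu1
        simp [hu0, hu1'] at this
      have e6 : (u 1 + ν * u 0) * (u 2 * v 3 + u 3 * v 2) ^ 2 + u 0 * u 1 ^ 2 * v 3 ^ 2 = 0 := by
        clear e1 e2 e3 hcoef hfst h hν hQ
        grind
      have e7 : v 3 ^ 2 * u 0 * (u 1 ^ 4 + u 1 * u 0 ^ 3 + ν * u 0 ^ 4) = 0 := by
        clear e0 e1 e2 e3 e4 hcoef hfst h hν hQ
        grind
      have e8 : u 1 ^ 4 + u 1 * u 0 ^ 3 + ν * u 0 ^ 4 = 0 := by simpa [hv3, hu0] using e7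
      refine (hν ((u 1 / u 0) ^ 2 + u 1 / u 0) ?_).elim
      clear e0 e1 e2 e3 e4 e5 e6 e7 hcoef hfst h hν hQ
      field_simp
      grind
  · rintro rfl
    refine ⟨finrank_cographPlane _, fun v hv => ?_⟩
    obtain ⟨h0, h1⟩ := mem_cographPlane.mp hv
    simp at h0 h1
    simp [h0, h1]

end FewLines

section Counting

variable {k : Type*} [Field k]

open scoped Polynomial

namespace Polynomial

lemma natDegree_prod_of_forall_monic {m : ℕ} {P : Fin m → k[X]} (hP : ∀ i, (P i).Monic)
    {e : Fin m → ℕ} (he : ∀ i, (P i).natDegree = e i) (s : Finset (Fin m)) :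
    (∏ i ∈ s, P i).natDegree = ∑ i ∈ s, e i := by
  rw [natDegree_prod_of_monic _ _ fun i _ => hP i]
  exact Finset.sum_congr rfl fun i _ => he i

/-- Factorisations of a product of distinct monic irreducible polynomials correspond to subsets
of the set of factors. -/
lemma encard_factorPairs_prod {m : ℕ} {P : Fin m → k[X]} (hP : ∀ i, (P i).Monic)
    (hirr : ∀ i, Irreducible (P i)) (hinj : Function.Injective P) {e : Fin m → ℕ}
    (he : ∀ i, (P i).natDegree = e i) (j : ℕ) :
    (factorPairs (∏ i, P i) j).encard =
      Finset.card {s : Finset (Fin m) | ∑ i ∈ s, e i ≤ j ∧ ∑ i ∈ sᶜ, e i ≤ 5 - j} := by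
  have hdvd (s : Finset (Fin m)) (i : Fin m) : P i ∣ ∏ l ∈ s, P l ↔ i ∈ s := by
    rw [(hirr i).prime.dvd_finsetProd_iff]
    refine ⟨fun ⟨l, hl, h⟩ => ?_, fun h => ⟨i, h, dvd_rfl⟩⟩
    rwa [hinj (eq_of_monic_of_associated (hP i) (hP l)
      ((hirr i).associated_of_dvd (hirr l) h))]
  have hinj' : Function.Injective fun s : Finset (Fin m) => (∏ i ∈ s, P i, ∏ i ∈ sᶜ, P i) := by
    intro s t h
    ext i
    have h1 : ∏ i ∈ s, P i = ∏ i ∈ t, P i := congrArg Prod.fst h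
    rw [← hdvd s, ← hdvd t, h1]
  rw [← Set.encard_coe_eq_coe_finsetCard, ← hinj'.encard_image]
  congr 1
  ext ⟨q, r⟩
  simp only [factorPairs, Set.mem_ofPred_eq, Set.mem_image, Finset.coe_filter, Finset.mem_univ,
    true_and, Prod.mk.injEq]
  constructor
  · rintro ⟨hq, hqr, hj, hj'⟩
    obtain ⟨s, t, b, c, hst, hdis, hbc, rfl, rfl⟩ :=
      mul_eq_mul_prime_prod (a := 1) (fun i _ => (hirr i).prime) (by rw [hqr, one_mul])
    have hb : b = 1 := (Monic.of_mul_monic_right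
      (monic_prod_of_monic _ _ fun i _ => hP i) hq).eq_one_of_isUnit (.of_mul_eq_one _ hbc.symm)
    obtain rfl : c = 1 := by simpa [hb] using hbc.symm
    obtain rfl : t = sᶜ := by
      refine eq_compl_iff_isCompl.mpr ⟨hdis.symm, ?_⟩
      rw [codisjoint_iff, sup_comm]
      exact hst
    rw [hb, one_mul, natDegree_prod_of_forall_monic hP he] at hj
    rw [one_mul, natDegree_prod_of_forall_monic hP he] at hj'
    exact ⟨s, ⟨hj, hj'⟩, by simp [hb], by simp⟩
  · rintro ⟨s, ⟨hj, hj'⟩, rfl, rfl⟩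
    refine ⟨monic_prod_of_monic _ _ fun i _ => hP i, Finset.prod_mul_prod_compl _ _, ?_, ?_⟩
    · rwa [natDegree_prod_of_forall_monic hP he]
    · rwa [natDegree_prod_of_forall_monic hP he]

lemma separable_prod_of_irreducible [Finite k] {m : ℕ} {P : Fin m → k[X]}
    (hP : ∀ i, (P i).Monic) (hirr : ∀ i, Irreducible (P i)) (hinj : Function.Injective P) :
    (∏ i, P i).Separable := by
  refine separable_prod (fun i l h => ?_) fun i => PerfectField.separable_of_irreducible (hirr i)
  refine (hirr i).isCoprime_or_dvd _ |>.resolve_right fun hd => h ?_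
  exact hinj (eq_of_monic_of_associated (hP i) (hP l) ((hirr i).associated_of_dvd (hirr l) hd))

lemma exists_monic_irreducible_natDegree_eq [CharP k 2] [Finite k] (n : ℕ) [NeZero n] :
    ∃ p : k[X], p.Monic ∧ Irreducible p ∧ p.natDegree = n := by
  have : Fact (Nat.Prime 2) := ⟨Nat.prime_two⟩
  obtain ⟨α, hα⟩ := Field.exists_primitive_element k (FiniteField.Extension k 2 n)
  have hint : IsIntegral k α := .of_finite k α
  refine ⟨minpoly k α, minpoly.monic hint, minpoly.irreducible hint, ?_⟩
  rw [(Field.primitive_element_iff_minpoly_natDegree_eq k α).mp hα,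
    FiniteField.finrank_extension]

end Polynomial

/-- A smooth cubic surface over `k` with exactly `n` lines exists. -/
def HasSmoothCubicWithLineCount (k : Type*) [Field k] (n : ℕ) : Prop :=
  ∃ f : MvPolynomial (Fin 4) k, IsSmoothCubic k f ∧ {W | IsLineOn f W}.encard = n

lemma hasSmoothCubicWithLineCount_of_irreducibles [CharP k 2] [Finite k] (hk : 4 ≤ Nat.card k)
    {m n : ℕ} {P : Fin m → k[X]} (hP : ∀ i, (P i).Monic) (hirr : ∀ i, Irreducible (P i))
    (hinj : Function.Injective P) (e : Fin m → ℕ) (he : ∀ i, (P i).natDegree = e i)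
    (h4 : 4 ≤ ∑ i, e i) (h5 : ∑ i, e i ≤ 5)
    (hn : 2 + 3 * Finset.card {s : Finset (Fin m) | ∑ i ∈ s, e i ≤ 1 ∧ ∑ i ∈ sᶜ, e i ≤ 4} +
      Finset.card {s : Finset (Fin m) | ∑ i ∈ s, e i ≤ 2 ∧ ∑ i ∈ sᶜ, e i ≤ 3} = n) :
    HasSmoothCubicWithLineCount k n := by
  have hdeg := Polynomial.natDegree_prod_of_forall_monic hP he Finset.univ
  have hsep := Polynomial.separable_prod_of_irreducible hP hirr hinj
  refine ⟨quinticCubic (∏ i, P i),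
    isSmoothCubic_quinticCubic hsep (hdeg ▸ h4) (hdeg ▸ h5), ?_⟩
  rw [encard_lines_quinticCubic hk hsep (hdeg ▸ h4) (hdeg ▸ h5),
    Polynomial.encard_factorPairs_prod hP hirr hinj he,
    Polynomial.encard_factorPairs_prod hP hirr hinj he, ← hn]
  push_cast
  rfl

lemma exists_forall_sq_add_ne [CharP k 2] [Finite k] : ∃ ν : k, ∀ t, t ^ 2 + t ≠ ν := by
  by_contra! h
  have hinj : Function.Injective fun t : k => t ^ 2 + t := Finite.injective_iff_surjective.mpr h
  exact zero_ne_one (hinj (by simp [CharTwo.add_self_eq_zero]))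

lemma exists_irreducible_quadratic_pair [CharP k 2] [Finite k] (hk : 4 ≤ Nat.card k) :
    ∃ p q : k[X], p ≠ q ∧ p.Monic ∧ q.Monic ∧ Irreducible p ∧ Irreducible q ∧
      p.natDegree = 2 ∧ q.natDegree = 2 := by
  obtain ⟨ν, hν⟩ := exists_forall_sq_add_ne (k := k)
  obtain ⟨ω, hω0, hω1⟩ := exists_ne_zero_ne_one hk
  let P (b : k) : k[X] := .X ^ 2 + .C b * .X + .C (b ^ 2 * ν)
  have hdeg (b : k) : (P b).natDegree = 2 := by
    unfold P
    compute_degree!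
  have hmonic (b : k) : (P b).Monic := by
    unfold P
    monicity!
  have hirr (b : k) (hb : b ≠ 0) : Irreducible (P b) := by
    refine Polynomial.irreducible_of_degree_le_three_of_not_isRoot (by simp [hdeg]) fun t ht => ?_
    refine hν (t / b) ?_
    simp [P] at ht
    field_simp
    grind
  refine ⟨P 1, P ω, fun h => hω1 ?_, hmonic 1, hmonic ω, hirr 1 one_ne_zero, hirr ω hω0,
    hdeg 1, hdeg ω⟩
  simpa [P, Polynomial.coeff_X, -map_mul, -map_pow] using
    (congrArg (fun p => Polynomial.coeff p 1) h).symm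

lemma hasSmoothCubicWithLineCount_twentySeven [CharP k 2] [Finite k] (hk : 4 ≤ Nat.card k) :
    HasSmoothCubicWithLineCount k 27 := by
  have := Fintype.ofFinite k
  obtain ⟨a⟩ := Function.Embedding.nonempty_of_card_le (α := Fin 4) (β := k)
    (by simpa [Nat.card_eq_fintype_card] using hk)
  let P (i : Fin 4) : k[X] := .X - .C (a i)
  have hdeg (i : Fin 4) : (P i).natDegree = 1 := Polynomial.natDegree_X_sub_C (a i)
  exact hasSmoothCubicWithLineCount_of_irreducibles hk
    (fun i => Polynomial.monic_X_sub_C (a i)) (fun i => Polynomial.irreducible_X_sub_C (a i))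
    (fun i j h => a.injective (by simpa [P] using h)) (fun _ => 1) hdeg
    (by decide) (by decide) (by decide)

lemma hasSmoothCubicWithLineCount_fifteen [CharP k 2] [Finite k] (hk : 4 ≤ Nat.card k) :
    HasSmoothCubicWithLineCount k 15 := by
  obtain ⟨p, hp, hpirr, hpdeg⟩ := Polynomial.exists_monic_irreducible_natDegree_eq (k := k) 2
  refine hasSmoothCubicWithLineCount_of_irreducibles hk (P := ![p, .X - .C 0, .X - .C 1])
    ?_ ?_ ?_ ![2, 1, 1] ?_ (by decide) (by decide) (by decide)
  · simp [Fin.forall_fin_succ, hp, Polynomial.monic_X_sub_C, -map_zero, -map_one]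
  · simp [Fin.forall_fin_succ, hpirr, Polynomial.irreducible_X_sub_C, -map_zero, -map_one]
  · have h0 : p ≠ .X - .C 0 := fun h => by simp [h] at hpdeg
    have h1 : p ≠ .X - .C 1 := fun h => by simp [h, -map_one] at hpdeg
    have h2 : (.X - .C 0 : k[X]) ≠ .X - .C 1 := fun h => by
      simp [-map_zero, -map_one] at h
    intro i j h
    fin_cases i <;> fin_cases j <;> first | rfl | exact absurd h ‹_› | exact absurd h.symm ‹_›
  · simp [Fin.forall_fin_succ, hpdeg, -map_zero, -map_one]

lemma hasSmoothCubicWithLineCount_of_pair [CharP k 2] [Finite k] (hk : 4 ≤ Nat.card k)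
    {p q : k[X]} (hp : p.Monic) (hq : q.Monic) (hpirr : Irreducible p) (hqirr : Irreducible q)
    (hpq : p ≠ q) {a b n : ℕ} (ha : p.natDegree = a) (hb : q.natDegree = b) (h4 : 4 ≤ a + b)
    (h5 : a + b ≤ 5)
    (hn : 2 + 3 * Finset.card {s : Finset (Fin 2) |
        ∑ i ∈ s, ![a, b] i ≤ 1 ∧ ∑ i ∈ sᶜ, ![a, b] i ≤ 4} +
      Finset.card {s : Finset (Fin 2) |
        ∑ i ∈ s, ![a, b] i ≤ 2 ∧ ∑ i ∈ sᶜ, ![a, b] i ≤ 3} = n) :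
    HasSmoothCubicWithLineCount k n := by
  refine hasSmoothCubicWithLineCount_of_irreducibles hk (P := ![p, q]) ?_ ?_ ?_ ![a, b] ?_
    (by simpa using h4) (by simpa using h5) hn
  · simp [hp, hq]
  · simp [hpirr, hqirr]
  · intro i j h
    fin_cases i <;> fin_cases j <;> first | rfl | exact absurd h hpq | exact absurd h.symm hpq
  · simp [ha, hb]

lemma hasSmoothCubicWithLineCount_of_pair_of_ne [CharP k 2] [Finite k] (hk : 4 ≤ Nat.card k)
    {a b n : ℕ} [NeZero a] [NeZero b] (hab : a ≠ b) (h4 : 4 ≤ a + b) (h5 : a + b ≤ 5)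
    (hn : 2 + 3 * Finset.card {s : Finset (Fin 2) |
        ∑ i ∈ s, ![a, b] i ≤ 1 ∧ ∑ i ∈ sᶜ, ![a, b] i ≤ 4} +
      Finset.card {s : Finset (Fin 2) |
        ∑ i ∈ s, ![a, b] i ≤ 2 ∧ ∑ i ∈ sᶜ, ![a, b] i ≤ 3} = n) :
    HasSmoothCubicWithLineCount k n := by
  obtain ⟨p, hp, hpirr, hpdeg⟩ := Polynomial.exists_monic_irreducible_natDegree_eq (k := k) a
  obtain ⟨q, hq, hqirr, hqdeg⟩ := Polynomial.exists_monic_irreducible_natDegree_eq (k := k) b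
  exact hasSmoothCubicWithLineCount_of_pair hk hp hq hpirr hqirr
    (fun h => hab (by rw [← hpdeg, ← hqdeg, h])) hpdeg hqdeg h4 h5 hn

lemma hasSmoothCubicWithLineCount_of_irreducible [CharP k 2] [Finite k] (hk : 4 ≤ Nat.card k)
    {a n : ℕ} [NeZero a] (h4 : 4 ≤ a) (h5 : a ≤ 5)
    (hn : 2 + 3 * Finset.card {s : Finset (Fin 1) |
        ∑ i ∈ s, ![a] i ≤ 1 ∧ ∑ i ∈ sᶜ, ![a] i ≤ 4} +
      Finset.card {s : Finset (Fin 1) |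
        ∑ i ∈ s, ![a] i ≤ 2 ∧ ∑ i ∈ sᶜ, ![a] i ≤ 3} = n) :
    HasSmoothCubicWithLineCount k n := by
  obtain ⟨p, hp, hpirr, hpdeg⟩ := Polynomial.exists_monic_irreducible_natDegree_eq (k := k) a
  exact hasSmoothCubicWithLineCount_of_irreducibles hk (P := ![p]) (by simp [hp])
    (by simp [hpirr]) (Function.injective_of_subsingleton _) ![a] (by simp [hpdeg])
    (by simpa using h4) (by simpa using h5) hn

lemma hasSmoothCubicWithLineCount_zero [CharP k 2] [Finite k] (hk : 4 ≤ Nat.card k) :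
    HasSmoothCubicWithLineCount k 0 := by
  obtain ⟨p, hp, hpirr, hpdeg⟩ := Polynomial.exists_monic_irreducible_natDegree_eq (k := k) 3
  refine ⟨splitCubic p, isSmoothCubic_splitCubic hp hpdeg
    (PerfectField.separable_of_irreducible hpirr), ?_⟩
  simp [not_isLineOn_splitCubic hk hp hpdeg hpirr]

lemma hasSmoothCubicWithLineCount_one [CharP k 2] [Finite k] (hk : 4 ≤ Nat.card k) :
    HasSmoothCubicWithLineCount k 1 := by
  obtain ⟨ν, hν⟩ := exists_forall_sq_add_ne (k := k)
  refine ⟨oneLineCubic ν, isSmoothCubic_oneLineCubic fun h => hν 0 (by simp [h]), ?_⟩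
  simp [isLineOn_oneLineCubic_iff hk hν]

lemma hasSmoothCubicWithLineCount_of_mem [CharP k 2] [Finite k] (hk : 4 ≤ Nat.card k) {n : ℕ}
    (hn : n ∈ ({0, 1, 2, 3, 5, 7, 9, 15, 27} : Set ℕ)) : HasSmoothCubicWithLineCount k n := by
  obtain rfl | rfl | rfl | rfl | rfl | rfl | rfl | rfl | rfl := hn
  · exact hasSmoothCubicWithLineCount_zero hk
  · exact hasSmoothCubicWithLineCount_one hk
  · exact hasSmoothCubicWithLineCount_of_irreducible hk (a := 5) (by simp) (by simp) (by decide)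
  · exact hasSmoothCubicWithLineCount_of_pair_of_ne hk (a := 2) (b := 3) (by simp) (by simp)
      (by simp) (by decide)
  · exact hasSmoothCubicWithLineCount_of_irreducible hk (a := 4) (by simp) (by simp) (by decide)
  · obtain ⟨p, q, hpq, hp, hq, hpirr, hqirr, hpdeg, hqdeg⟩ := exists_irreducible_quadratic_pair hk
    exact hasSmoothCubicWithLineCount_of_pair hk hp hq hpirr hqirr hpq hpdeg hqdeg (by simp)
      (by simp) (by decide)
  · exact hasSmoothCubicWithLineCount_of_pair_of_ne hk (a := 1) (b := 3) (by simp) (by simp)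
      (by simp) (by decide)
  · exact hasSmoothCubicWithLineCount_fifteen hk
  · exact hasSmoothCubicWithLineCount_twentySeven hk

end Counting

/-- each count in {0,1,2,3,5,7,9,15,27} is realized by a smooth cubic
surface over the finite field with `2 ^ d` elements, for every `d > 1`. -/
theorem exists_smooth_cubic_char_two_with_line_count (d : ℕ) (hd : 1 < d) :
    ∀ n ∈ ({0, 1, 2, 3, 5, 7, 9, 15, 27} : Set ℕ),
      ∃ f : MvPolynomial (Fin 4) (GaloisField 2 d), IsSmoothCubic (GaloisField 2 d) f ∧
        {W : Submodule (GaloisField 2 d) (Fin 4 → GaloisField 2 d) | IsLineOn f W}.Finite ∧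
        {W : Submodule (GaloisField 2 d) (Fin 4 → GaloisField 2 d) | IsLineOn f W}.ncard
          = n := by
  intro n hn
  have hd0 : d ≠ 0 := by omega
  have hk : 4 ≤ Nat.card (GaloisField 2 d) := by
    rw [GaloisField.card 2 d hd0]
    exact Nat.pow_le_pow_right two_pos hd
  obtain ⟨f, hf, hcard⟩ := hasSmoothCubicWithLineCount_of_mem hk hn
  exact ⟨f, hf, Set.finite_of_encard_eq_coe hcard, by simp [Set.ncard, hcard]⟩
end

section
/- Let F₈ be the finite field with 8 elements and let f = x₀²x₃ + x₁²x₂ + x₀x₃² + x₁x₂² + x₁x₂x₃, a homogeneous cubic in four variables over F₈. Then f defines a smooth cubic surface, and the set of lines on V(f) defined over F₈ has exactly 27 elements. -/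
open MvPolynomial

open Module Submodule

/-- The value at `x` of `x₀²x₃ + x₁²x₂ + x₀x₃² + x₁x₂² + x₁x₂x₃`. -/
def cubicVal {k : Type*} [CommRing k] (x : Fin 4 → k) : k :=
  x 0 ^ 2 * x 3 + x 1 ^ 2 * x 2 + x 0 * x 3 ^ 2 + x 1 * x 2 ^ 2 + x 1 * x 2 * x 3

/-- The derivative of `cubicVal` at `x` in the direction `y`. -/
def cubicPolar {k : Type*} [CommRing k] (x y : Fin 4 → k) : k :=
  (2 * x 0 * x 3 + x 3 ^ 2) * y 0 + (2 * x 1 * x 2 + x 2 ^ 2 + x 2 * x 3) * y 1 +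
    (x 1 ^ 2 + 2 * x 1 * x 2 + x 1 * x 3) * y 2 + (x 0 ^ 2 + 2 * x 0 * x 3 + x 1 * x 2) * y 3

theorem lineRestrict_cubic_eq_zero_iff {k : Type*} [CommRing k] (v w : Fin 4 → k) :
    lineRestrict (X 0 ^ 2 * X 3 + X 1 ^ 2 * X 2 + X 0 * X 3 ^ 2 + X 1 * X 2 ^ 2 +
        X 1 * X 2 * X 3 : MvPolynomial (Fin 4) k) v w = 0 ↔
      cubicVal v = 0 ∧ cubicPolar v w = 0 ∧ cubicPolar w v = 0 ∧ cubicVal w = 0 := by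
  have key : lineRestrict (X 0 ^ 2 * X 3 + X 1 ^ 2 * X 2 + X 0 * X 3 ^ 2 + X 1 * X 2 ^ 2 +
        X 1 * X 2 * X 3 : MvPolynomial (Fin 4) k) v w =
      C (cubicVal v) * X 0 ^ 3 + C (cubicPolar v w) * X 0 ^ 2 * X 1 +
        C (cubicPolar w v) * X 0 * X 1 ^ 2 + C (cubicVal w) * X 1 ^ 3 := by
    simp only [lineRestrict, cubicVal, cubicPolar, map_add, map_mul, map_pow, aeval_X, map_ofNat]
    ring
  rw [key]
  constructor
  · intro h
    have h' := congrArg (aeval ![(Polynomial.X : Polynomial k), 1]) h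
    simp only [map_add, map_mul, map_pow, aeval_X, aeval_C, map_zero,
      Polynomial.algebraMap_eq, Matrix.cons_val_zero, Matrix.cons_val_one, one_pow, mul_one] at h'
    have h0 := congrArg (Polynomial.coeff · 0) h'
    have h1 := congrArg (Polynomial.coeff · 1) h'
    have h2 := congrArg (Polynomial.coeff · 2) h'
    have h3 := congrArg (Polynomial.coeff · 3) h'
    simp [Polynomial.coeff_X, Polynomial.coeff_C] at h0 h1 h2 h3
    exact ⟨h3, h2, h1, h0⟩
  · rintro ⟨h0, h1, h2, h3⟩
    simp [h0, h1, h2, h3]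

theorem cubicVal_eq_zero_and_cubicPolar_eq_zero_of_isLineOn {k : Type*} [Field k]
    {W : Submodule k (Fin 4 → k)}
    (hW : IsLineOn (X 0 ^ 2 * X 3 + X 1 ^ 2 * X 2 + X 0 * X 3 ^ 2 + X 1 * X 2 ^ 2 +
        X 1 * X 2 * X 3 : MvPolynomial (Fin 4) k) W) {x y : Fin 4 → k}
    (hx : x ∈ W) (hy : y ∈ W) : cubicVal x = 0 ∧ cubicPolar x y = 0 := by
  obtain ⟨-, v, w, rfl, h⟩ := hW
  obtain ⟨h0, h1, h2, h3⟩ := (lineRestrict_cubic_eq_zero_iff v w).1 h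
  obtain ⟨a, b, rfl⟩ := mem_span_pair.1 hx
  obtain ⟨c, d, rfl⟩ := mem_span_pair.1 hy
  simp only [cubicVal, cubicPolar, Pi.add_apply, Pi.smul_apply, smul_eq_mul] at *
  constructor
  · linear_combination a ^ 3 * h0 + a ^ 2 * b * h1 + a * b ^ 2 * h2 + b ^ 3 * h3
  · linear_combination 3 * a ^ 2 * c * h0 + (a ^ 2 * d + 2 * a * b * c) * h1 +
      (b ^ 2 * c + 2 * a * b * d) * h2 + 3 * b ^ 2 * d * h3

/-- The points other than `(1, 0, 0, 0)` on the three lines of the surface in the plane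
`x₃ = 0`. -/
def planarPoint {k : Type*} [CommRing k] (d : Fin 3) (a : k) : Fin 4 → k :=
  ![![a, 0, 1, 0], ![a, 1, 0, 0], ![a, 1, 1, 0]] d

/-- A second point on a line of the surface through `planarPoint d a`. -/
def affinePoint {k : Type*} [CommRing k] (d : Fin 3) (a b : k) : Fin 4 → k :=
  ![![b, a ^ 2, 0, 1], ![b, 0, a ^ 2, 1], ![b, a ^ 2 + 1, 0, 1]] d

/-- The lines of the surface: three in the plane `x₃ = 0`, and those meeting this plane
in one point. -/
def cubicLine {k : Type*} [Field k] :
    Fin 3 × Option ({a : k | a ^ 4 + a ^ 2 + a = 0} × ({0, 1} : Set k)) →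
      Submodule k (Fin 4 → k)
  | (d, none) => span k {![1, 0, 0, 0], planarPoint d 0}
  | (d, some (a, b)) => span k {planarPoint d a.1, affinePoint d a.1 b.1}

theorem finrank_span_pair_eq_two_s16 {k V : Type*} [Field k] [AddCommGroup V] [Module k V] {v w : V}
    (h : LinearIndependent k ![v, w]) : finrank k (span k {v, w}) = 2 := by
  have := finrank_span_eq_card h
  rwa [Matrix.range_cons_cons_empty, Fintype.card_fin] at this

theorem linearIndependent_planarPoint {k : Type*} [Field k] (d : Fin 3) :
    LinearIndependent k ![![1, 0, 0, 0], planarPoint d (0 : k)] := by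
  rw [LinearIndependent.pair_iff]
  intro s t h
  have h0 := congrFun h 0
  have h1 := congrFun h 1
  have h2 := congrFun h 2
  fin_cases d <;> simp [planarPoint] at h0 h1 h2 <;> simp [*]

theorem linearIndependent_planarPoint_affinePoint {k : Type*} [Field k] (d : Fin 3) (a b : k) :
    LinearIndependent k ![planarPoint d a, affinePoint d a b] := by
  rw [LinearIndependent.pair_iff]
  intro s t h
  have h1 := congrFun h 1
  have h2 := congrFun h 2
  have h3 := congrFun h 3
  fin_cases d <;> simp [planarPoint, affinePoint] at h1 h2 h3 <;> simp_all

theorem finrank_cubicLine {k : Type*} [Field k]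
    (i : Fin 3 × Option ({a : k | a ^ 4 + a ^ 2 + a = 0} × ({0, 1} : Set k))) :
    finrank k (cubicLine i) = 2 := by
  obtain ⟨d, _ | ⟨a, b⟩⟩ := i
  · exact finrank_span_pair_eq_two_s16 (linearIndependent_planarPoint d)
  · exact finrank_span_pair_eq_two_s16 (linearIndependent_planarPoint_affinePoint d a.1 b.1)

theorem isLineOn_cubicLine {k : Type*} [Field k] [CharP k 2]
    (i : Fin 3 × Option ({a : k | a ^ 4 + a ^ 2 + a = 0} × ({0, 1} : Set k))) :
    IsLineOn (X 0 ^ 2 * X 3 + X 1 ^ 2 * X 2 + X 0 * X 3 ^ 2 + X 1 * X 2 ^ 2 +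
        X 1 * X 2 * X 3 : MvPolynomial (Fin 4) k) (cubicLine i) := by
  refine ⟨finrank_cubicLine i, ?_⟩
  obtain ⟨d, _ | ⟨⟨a, ha⟩, ⟨b, hb⟩⟩⟩ := i
  · refine ⟨_, _, rfl, (lineRestrict_cubic_eq_zero_iff _ _).2 ?_⟩
    fin_cases d <;> simp [cubicVal, cubicPolar, planarPoint]
    grind
  · refine ⟨_, _, rfl, (lineRestrict_cubic_eq_zero_iff _ _).2 ?_⟩
    simp only [Set.mem_ofPred_eq, Set.mem_insert_iff, Set.mem_singleton_iff] at ha hb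
    fin_cases d <;> simp [cubicVal, cubicPolar, planarPoint, affinePoint] <;> grind

theorem cubicLine_injective {k : Type*} [Field k] : Function.Injective (cubicLine (k := k)) := by
  rintro ⟨d, _ | ⟨⟨a, ha⟩, ⟨b, hb⟩⟩⟩ ⟨d', _ | ⟨⟨a', ha'⟩, ⟨b', hb'⟩⟩⟩ h
  · have hm : planarPoint d (0 : k) ∈ cubicLine (d', none) := by
      rw [← h]; exact subset_span (by simp)
    obtain ⟨s, t, hst⟩ := mem_span_pair.1 hm
    have h1 := congrFun hst 1
    have h2 := congrFun hst 2
    fin_cases d <;> fin_cases d' <;> simp [planarPoint] at h1 h2 ⊢ <;> simp_all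
  · have hm : affinePoint d' a' b' ∈ cubicLine (d, none) := by
      rw [h]; exact subset_span (by simp)
    obtain ⟨s, t, hst⟩ := mem_span_pair.1 hm
    have h3 := congrFun hst 3
    fin_cases d <;> fin_cases d' <;> simp [planarPoint, affinePoint] at h3
  · have hm : affinePoint d a b ∈ cubicLine (d', none) := by
      rw [← h]; exact subset_span (by simp)
    obtain ⟨s, t, hst⟩ := mem_span_pair.1 hm
    have h3 := congrFun hst 3
    fin_cases d <;> fin_cases d' <;> simp [planarPoint, affinePoint] at h3
  · have hp : planarPoint d a ∈ cubicLine (d', some (⟨a', ha'⟩, ⟨b', hb'⟩)) := by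
      rw [← h]; exact subset_span (by simp)
    have hq : affinePoint d a b ∈ cubicLine (d', some (⟨a', ha'⟩, ⟨b', hb'⟩)) := by
      rw [← h]; exact subset_span (by simp)
    obtain ⟨s, t, hst⟩ := mem_span_pair.1 hp
    obtain ⟨s', t', hst'⟩ := mem_span_pair.1 hq
    have h0 := congrFun hst 0
    have h1 := congrFun hst 1
    have h2 := congrFun hst 2
    have h3 := congrFun hst 3
    have h0' := congrFun hst' 0
    have h1' := congrFun hst' 1
    have h2' := congrFun hst' 2
    have h3' := congrFun hst' 3
    fin_cases d <;> fin_cases d' <;>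
      simp [planarPoint, affinePoint] at h0 h1 h2 h3 h0' h1' h2' h3' ⊢ <;> grind

/-- A plane `W` of vectors contains a nonzero vector in any hyperplane. -/
theorem exists_mem_ne_zero_of_finrank_eq_two {k V : Type*} [Field k] [AddCommGroup V] [Module k V]
    {W : Submodule k V} (hW : finrank k W = 2) (φ : V →ₗ[k] k) : ∃ v ∈ W, v ≠ 0 ∧ φ v = 0 := by
  have : FiniteDimensional k W := FiniteDimensional.of_finrank_pos (by omega)
  have hker : (φ.domRestrict W).ker ≠ ⊥ :=
    LinearMap.ker_ne_bot_of_finrank_lt (by rw [hW, finrank_self]; norm_num)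
  obtain ⟨v, hv, hv0⟩ := exists_mem_ne_zero_of_ne_bot hker
  exact ⟨v, v.2, by simpa using hv0, hv⟩

/-- Up to scaling, every point of the surface in the plane `x₃ = 0` other than `(1, 0, 0, 0)`
is a `planarPoint`. -/
theorem exists_smul_eq_planarPoint {k : Type*} [Field k] [CharP k 2] {v : Fin 4 → k}
    (hv : cubicVal v = 0) (h3 : v 3 = 0) (h12 : v 1 ≠ 0 ∨ v 2 ≠ 0) :
    ∃ d : Fin 3, ∃ c : k, c • v = planarPoint d (c * v 0) := by
  have hprod : v 1 * v 2 * (v 1 + v 2) = 0 := by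
    simp only [cubicVal, h3] at hv
    linear_combination hv
  by_cases h1 : v 1 = 0
  · have h2 : v 2 ≠ 0 := by tauto
    refine ⟨0, (v 2)⁻¹, ?_⟩
    ext i; fin_cases i <;> simp [planarPoint, h1, h2, h3]
  by_cases h2 : v 2 = 0
  · refine ⟨1, (v 1)⁻¹, ?_⟩
    ext i; fin_cases i <;> simp [planarPoint, h1, h2, h3]
  · have h : v 2 = v 1 := by grind
    refine ⟨2, (v 1)⁻¹, ?_⟩
    ext i; fin_cases i <;> simp [planarPoint, h1, h, h3]

theorem isLineOn_cubic_iff {k : Type*} [Field k] [CharP k 2] (W : Submodule k (Fin 4 → k)) :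
    IsLineOn (X 0 ^ 2 * X 3 + X 1 ^ 2 * X 2 + X 0 * X 3 ^ 2 + X 1 * X 2 ^ 2 +
        X 1 * X 2 * X 3 : MvPolynomial (Fin 4) k) W ↔ W ∈ Set.range (cubicLine (k := k)) := by
  refine ⟨fun hW => ?_, fun ⟨i, hi⟩ => hi ▸ isLineOn_cubicLine i⟩
  have hval {x} (hx : x ∈ W) : cubicVal x = 0 :=
    (cubicVal_eq_zero_and_cubicPolar_eq_zero_of_isLineOn hW hx hx).1
  have hpol {x y} (hx : x ∈ W) (hy : y ∈ W) : cubicPolar x y = 0 :=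
    (cubicVal_eq_zero_and_cubicPolar_eq_zero_of_isLineOn hW hx hy).2
  by_cases hplane : ∀ x ∈ W, x 3 = 0
  · obtain ⟨v, hv, hv0, hv00⟩ := exists_mem_ne_zero_of_finrank_eq_two hW.1 (LinearMap.proj 0)
    simp only [LinearMap.proj_apply] at hv00
    obtain ⟨d, c, hd⟩ := exists_smul_eq_planarPoint (hval hv) (hplane v hv) (by
      by_contra! h
      exact hv0 (by ext i; fin_cases i <;> simp [hv00, h.1, h.2, hplane v hv]))
    have hp : planarPoint d (0 : k) ∈ W := by
      have := W.smul_mem c hv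
      rwa [hd, hv00, mul_zero] at this
    refine ⟨(d, none), (eq_of_le_of_finrank_eq (fun x hx => ?_) ?_).symm⟩
    · have hx3 := hplane x hx
      have hpx := hpol hp hx
      rw [cubicLine, mem_span_pair]
      fin_cases d <;> simp [cubicPolar, planarPoint, hx3] at hpx
      · exact ⟨x 0, x 2, by ext i; fin_cases i <;> simp [planarPoint, hpx, hx3]⟩
      · exact ⟨x 0, x 1, by ext i; fin_cases i <;> simp [planarPoint, hpx, hx3]⟩
      · have : x 2 = x 1 := by grind
        exact ⟨x 0, x 1, by ext i; fin_cases i <;> simp [planarPoint, this, hx3]⟩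
    · rw [hW.1, finrank_cubicLine]
  · push Not at hplane
    obtain ⟨r, hr, hr3⟩ := hplane
    obtain ⟨v, hv, hv0, hv3⟩ := exists_mem_ne_zero_of_finrank_eq_two hW.1 (LinearMap.proj 3)
    simp only [LinearMap.proj_apply] at hv3
    obtain ⟨d, c, hd⟩ := exists_smul_eq_planarPoint (hval hv) hv3 (by
      by_contra! h
      have h0 := hpol hv hr
      simp only [cubicPolar, h.1, h.2, hv3] at h0
      have : v 0 = 0 := by grind
      exact hv0 (by ext i; fin_cases i <;> simp [this, h.1, h.2, hv3]))
    set a := c * v 0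
    have hp : planarPoint d a ∈ W := hd ▸ W.smul_mem c hv
    obtain ⟨q, hq, hq3, hqd⟩ : ∃ q ∈ W, q 3 = 1 ∧ (if d = 1 then q 1 = 0 else q 2 = 0) := by
      refine ⟨(r 3)⁻¹ • r - ((r 3)⁻¹ * if d = 1 then r 1 else r 2) • planarPoint d a,
        W.sub_mem (W.smul_mem _ hr) (W.smul_mem _ hp), ?_⟩
      fin_cases d <;> simp [planarPoint, hr3]
    have hval_q := hval hq
    have hpq := hpol hp hq
    have hqp := hpol hq hp
    have hqa : q = affinePoint d a (q 0) := by
      ext i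
      fin_cases d <;> fin_cases i <;>
        simp [cubicPolar, planarPoint, affinePoint, hq3] at hpq hqd ⊢ <;> grind
    have hb : q 0 = 0 ∨ q 0 = 1 := by
      fin_cases d <;> simp [cubicVal, hq3] at hval_q hqd <;> grind
    have ha : a ^ 4 + a ^ 2 + a = 0 := by
      rw [hqa] at hqp
      fin_cases d <;> simp [cubicPolar, planarPoint, affinePoint] at hqp <;> grind
    refine ⟨(d, some (⟨a, ha⟩, ⟨q 0, hb⟩)), eq_of_le_of_finrank_eq ?_ ?_⟩
    · rw [cubicLine, span_le, ← hqa]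
      rintro x (rfl | rfl)
      exacts [hp, hq]
    · rw [hW.1, finrank_cubicLine]

/-- In the field with eight elements exactly four elements have trace zero over the prime field. -/
theorem ncard_trace_eq_zero {k : Type*} [Field k] [CharP k 2] (hk : Nat.card k = 8) :
    {a : k | a ^ 4 + a ^ 2 + a = 0}.ncard = 4 := by
  classical
  have h2 : (2 : k) = 0 := CharTwo.two_eq_zero
  have : Finite k := Nat.finite_of_card_ne_zero (by omega)
  have bound (c : k) : {a : k | a ^ 4 + a ^ 2 + a = c}.ncard ≤ 4 := by
    let p : Polynomial k := Polynomial.X ^ 4 + Polynomial.X ^ 2 + Polynomial.X - Polynomial.C c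
    have hdeg : p.natDegree = 4 := by unfold p; compute_degree!
    have hp : p ≠ 0 := by rintro h; simp [h] at hdeg
    have hsub : {a : k | a ^ 4 + a ^ 2 + a = c} ⊆ (p.roots.toFinset : Set k) := by
      intro a ha
      simp only [Set.mem_ofPred_eq] at ha
      simp [hp, p, Polynomial.IsRoot, ha]
    calc _ ≤ p.roots.toFinset.card := by
            rw [← Set.ncard_coe_finset]; exact Set.ncard_le_ncard hsub
      _ ≤ p.roots.card := p.roots.toFinset_card_le
      _ ≤ 4 := hdeg ▸ p.card_roots'
  have hunion : {a : k | a ^ 4 + a ^ 2 + a = 0} ∪ {a : k | a ^ 4 + a ^ 2 + a = 1} = Set.univ := by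
    refine Set.eq_univ_of_forall fun a => ?_
    have h8 : a ^ 8 = a := by
      have := Fintype.ofFinite k
      rw [← hk, Nat.card_eq_fintype_card, FiniteField.pow_card]
    have : (a ^ 4 + a ^ 2 + a) * (a ^ 4 + a ^ 2 + a - 1) = 0 := by
      linear_combination h8 + (a ^ 6 + a ^ 5 + a ^ 3) * h2
    simpa [sub_eq_zero] using this
  have hle := Set.ncard_union_le {a : k | a ^ 4 + a ^ 2 + a = 0} {a : k | a ^ 4 + a ^ 2 + a = 1}
  rw [hunion, Set.ncard_univ, hk] at hle
  have := bound 0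
  have := bound 1
  omega

theorem isSmoothCubic_cubic {k : Type*} [Field k] [CharP k 2] :
    IsSmoothCubic k (X 0 ^ 2 * X 3 + X 1 ^ 2 * X 2 + X 0 * X 3 ^ 2 + X 1 * X 2 ^ 2 +
      X 1 * X 2 * X 3 : MvPolynomial (Fin 4) k) := by
  refine ⟨fun h => ?_, ?_, ?_⟩
  · have h1 := congrArg (eval ![0, 1, 1, 1]) h
    simp at h1
    grind
  · have hX (i : Fin 4) : (X i : MvPolynomial (Fin 4) k).IsHomogeneous 1 := isHomogeneous_X k i
    exact (((((hX 0).pow 2).mul (hX 3)).add (((hX 1).pow 2).mul (hX 2))).add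
      ((hX 0).mul ((hX 3).pow 2))).add ((hX 1).mul ((hX 2).pow 2)) |>.add
      (((hX 1).mul (hX 2)).mul (hX 3))
  · rintro x ⟨-, h⟩
    have : CharP (AlgebraicClosure k) 2 := charP_of_injective_algebraMap' k 2
    have h2 : (2 : AlgebraicClosure k) = 0 := CharTwo.two_eq_zero
    have d0 := h 0
    have d1 := h 1
    have d2 := h 2
    have d3 := h 3
    simp [pderiv_X, h2] at d0 d1 d2 d3
    have e3 : x 3 = 0 := by grind
    have e2 : x 2 = 0 := by grind
    have e1 : x 1 = 0 := by grind
    have e0 : x 0 = 0 := by grind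
    ext i
    fin_cases i <;> simp [e0, e1, e2, e3]

/-- the cubic `x₀²x₃ + x₁²x₂ + x₀x₃² + x₁x₂² + x₁x₂x₃` over `𝔽₈` is a
smooth cubic surface with exactly 27 lines over `𝔽₈`. -/
theorem explicit_cubic_F8_has_27_lines :
    IsSmoothCubic (GaloisField 2 3)
      (X 0 ^ 2 * X 3 + X 1 ^ 2 * X 2 + X 0 * X 3 ^ 2 + X 1 * X 2 ^ 2 + X 1 * X 2 * X 3 :
        MvPolynomial (Fin 4) (GaloisField 2 3)) ∧
    {W : Submodule (GaloisField 2 3) (Fin 4 → GaloisField 2 3) |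
      IsLineOn (X 0 ^ 2 * X 3 + X 1 ^ 2 * X 2 + X 0 * X 3 ^ 2 + X 1 * X 2 ^ 2 +
        X 1 * X 2 * X 3 : MvPolynomial (Fin 4) (GaloisField 2 3)) W}.Finite ∧
    {W : Submodule (GaloisField 2 3) (Fin 4 → GaloisField 2 3) |
      IsLineOn (X 0 ^ 2 * X 3 + X 1 ^ 2 * X 2 + X 0 * X 3 ^ 2 + X 1 * X 2 ^ 2 +
        X 1 * X 2 * X 3 : MvPolynomial (Fin 4) (GaloisField 2 3)) W}.ncard = 27 := by
  have hk : Nat.card (GaloisField 2 3) = 8 := by rw [GaloisField.card 2 3 (by norm_num)]; norm_num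
  have hset := Set.ext (isLineOn_cubic_iff (k := GaloisField 2 3))
  have : Finite (GaloisField 2 3) := Nat.finite_of_card_ne_zero (by omega)
  refine ⟨isSmoothCubic_cubic, ?_, ?_⟩
  · exact hset ▸ Set.finite_range _
  · refine (congrArg Set.ncard hset).trans ?_
    rw [← Nat.card_coe_set_eq, Nat.card_range_of_injective cubicLine_injective, Nat.card_prod,
      Finite.card_option, Nat.card_prod, Nat.card_coe_set_eq, Nat.card_coe_set_eq,
      ncard_trace_eq_zero hk, Set.ncard_pair zero_ne_one, Nat.card_fin]
end

section
/- Let p be a prime, n ≥ 1 an integer, and let F be the finite field with p^n elements. Let d ≥ 1 be an integer coprime to p. For a ∈ F, let N_d(p^n, a) denote the set of monic irreducible polynomials of degree d over F whose coefficient of X^{d-1} equals a, and let N_d(p^n) denote the set of all monic irreducible polynomials of degree d over F. Then for every a ∈ F, p^n · |N_d(p^n, a)| = |N_d(p^n)|; in particular, |N_d(p^n, a)| is independent of a. -/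
open Polynomial in
theorem coeff_taylor_natDegree_sub_one {R : Type*} [CommRing R] (f : R[X]) (r : R)
    (hf : 1 ≤ f.natDegree) :
    (taylor r f).coeff (f.natDegree - 1) =
      f.coeff (f.natDegree - 1) + f.natDegree * f.leadingCoeff * r := by
  obtain ⟨k, hk⟩ : ∃ k, f.natDegree = k + 1 := ⟨f.natDegree - 1, by omega⟩
  have hdeg : (hasseDeriv k f).natDegree < 2 := by
    have := natDegree_hasseDeriv_le f k
    omega
  rw [leadingCoeff, hk, Nat.add_sub_cancel, taylor_coeff, eval_eq_sum_range' hdeg]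
  simp [Finset.sum_range_succ, hasseDeriv_coeff, Nat.add_comm 1 k]

open Polynomial in
theorem finite_setOf_natDegree_eq (R : Type*) [Semiring R] [Finite R] (d : ℕ) :
    {g : R[X] | g.natDegree = d}.Finite := by
  refine Set.Finite.of_finite_image (f := fun g (i : Fin (d + 1)) => g.coeff i)
    (Set.toFinite _) fun g hg h hh hgh => ?_
  ext i
  by_cases hi : i < d + 1
  · exact congrFun hgh ⟨i, hi⟩
  · rw [Set.mem_ofPred_eq] at hg hh
    rw [coeff_eq_zero_of_natDegree_lt (by omega), coeff_eq_zero_of_natDegree_lt (by omega)]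

open Polynomial in
theorem irreducible_taylor {R : Type*} [CommRing R] {f : R[X]} (r : R) (hf : Irreducible f) :
    Irreducible (taylor r f) :=
  (MulEquiv.irreducible_iff (taylorEquiv r)).mpr hf

/-- over the finite field `F` of order `p ^ n`, for `d` coprime to `p`,
the number of monic irreducible polynomials of degree `d` with a prescribed coefficient
of `X ^ (d - 1)` is `1 / p ^ n` times the total number of monic irreducible polynomials
of degree `d`. -/
theorem count_monic_irreducible_prescribed_subleading_coeff
    (p n d : ℕ) (hp : p.Prime) (hn : 1 ≤ n) (hd : 1 ≤ d) (hcop : Nat.Coprime d p)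
    (F : Type*) [Field F] [Fintype F] (hF : Fintype.card F = p ^ n) (a : F) :
    {g : Polynomial F | g.Monic ∧ g.natDegree = d ∧ Irreducible g}.Finite ∧
    p ^ n * {g : Polynomial F | g.Monic ∧ g.natDegree = d ∧ Irreducible g ∧
        g.coeff (d - 1) = a}.ncard =
      {g : Polynomial F | g.Monic ∧ g.natDegree = d ∧ Irreducible g}.ncard := by
  refine ⟨(finite_setOf_natDegree_eq F d).subset fun g hg => hg.2.1, ?_⟩
  have hd0 : (d : F) ≠ 0 := by
    intro h
    have hcast : ((p ^ n : ℕ) : F) = 0 := by rw [← hF, Nat.cast_card_eq_zero]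
    have hone := (Nat.isCoprime_iff_coprime.mpr (hcop.pow_right n)).map (Int.castRingHom F)
    simp only [map_natCast, h, hcast] at hone
    exact not_isCoprime_zero_zero hone
  have hcoeff (c : F) (g : Polynomial F) (hm : g.Monic) (hg : g.natDegree = d) :
      (Polynomial.taylor c g).coeff (d - 1) = g.coeff (d - 1) + d * c := by
    have := coeff_taylor_natDegree_sub_one g c (hg ▸ hd)
    rwa [hm.leadingCoeff, mul_one, hg] at this
  have hmonic (c : F) (g : Polynomial F) (hm : g.Monic) : (Polynomial.taylor c g).Monic := by
    rw [Polynomial.Monic, Polynomial.leadingCoeff_taylor, hm.leadingCoeff]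
  rw [← hF, ← Nat.card_eq_fintype_card, ← Set.ncard_univ, ← Set.ncard_prod]
  refine Set.ncard_congr (fun x _ => Polynomial.taylor x.1 x.2) ?_ ?_ ?_
  · rintro ⟨c, g⟩ ⟨-, hm, hg, hi, -⟩
    exact ⟨hmonic c g hm, by rw [Polynomial.natDegree_taylor, hg], irreducible_taylor c hi⟩
  · rintro ⟨c, g⟩ ⟨c', g'⟩ ⟨-, hm, hg, -, ha⟩ ⟨-, hm', hg', -, ha'⟩ h
    have hsub := congrArg (fun f => f.coeff (d - 1)) h
    simp only [hcoeff c g hm hg, hcoeff c' g' hm' hg', ha, ha', add_right_inj,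
      mul_right_inj' hd0] at hsub
    subst hsub
    exact congrArg _ (Polynomial.taylor_injective c h)
  · rintro g ⟨hm, hg, hi⟩
    set c := (g.coeff (d - 1) - a) / d with hc
    refine ⟨(c, Polynomial.taylor (-c) g), ⟨Set.mem_univ _, hmonic _ g hm,
      by rw [Polynomial.natDegree_taylor, hg], irreducible_taylor _ hi, ?_⟩, ?_⟩
    · rw [hcoeff _ g hm hg, hc]
      field_simp
      ring
    · simp [Polynomial.taylor_taylor]
end

section
/- Let d ≥ 1 be an integer and let F be the finite field with 2^d elements. There exist e₁, e₂, e₃, e₄ ∈ F such that the polynomial X⁵ + X⁴ + e₁X³ + e₂X² + e₃X + e₄ is irreducible over F and no three of its roots in an algebraic closure of F sum to zero (i.e., for any three distinct roots α, β, γ in the algebraic closure, α + β + γ ≠ 0). -/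
open Polynomial

open IntermediateField in
/-- The trace of a primitive element is minus the next-to-leading coefficient of its minimal
polynomial. -/
theorem Algebra.trace_eq_neg_nextCoeff_of_natDegree_eq_finrank {F E : Type*} [Field F] [Field E]
    [Algebra F E] [FiniteDimensional F E] {x : E}
    (hx : (minpoly F x).natDegree = Module.finrank F E) :
    Algebra.trace F E x = -(minpoly F x).nextCoeff := by
  have hmul := Module.finrank_mul_finrank F F⟮x⟯ E
  rw [adjoin.finrank (Algebra.IsIntegral.isIntegral x), hx] at hmul
  rw [trace_eq_finrank_mul_minpoly_nextCoeff, (Nat.mul_eq_left Module.finrank_pos.ne').1 hmul,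
    Nat.cast_one, one_mul]

/-- In characteristic two, an extension of degree five is generated by an element whose minimal
polynomial has next-to-leading coefficient one. -/
theorem exists_minpoly_natDegree_eq_five_nextCoeff_eq_one (F E : Type*) [Field F] [CharP F 2]
    [Field E] [Algebra F E] (hE : Module.finrank F E = 5) :
    ∃ a : E, (minpoly F a).natDegree = 5 ∧ (minpoly F a).nextCoeff = 1 := by
  have : FiniteDimensional F E := Module.finite_of_finrank_pos (by omega)
  have h5 : ((5 : ℕ) : F) = 1 := by
    have := CharTwo.two_eq_zero (R := F)
    push_cast
    linear_combination 2 * this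
  have htr (c : F) : Algebra.trace F E (algebraMap F E c) = c := by
    rw [Algebra.trace_algebraMap, hE, nsmul_eq_mul, h5, one_mul]
  obtain ⟨k, hk, hk0⟩ := (LinearMap.ker (Algebra.trace F E)).exists_mem_ne_zero_of_ne_bot
    (LinearMap.ker_ne_bot_of_finrank_lt (by rw [hE]; simp))
  rw [LinearMap.mem_ker] at hk
  have hat : Algebra.trace F E (1 + k) = 1 := by
    rw [map_add, hk, add_zero, ← map_one (algebraMap F E), htr]
  have hdeg : (minpoly F (1 + k)).natDegree = 5 := by
    have hdvd := minpoly.degree_dvd (Algebra.IsIntegral.isIntegral (R := F) (1 + k))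
    rw [hE] at hdvd
    refine ((Nat.dvd_prime Nat.prime_five).1 hdvd).resolve_left fun h ↦ hk0 ?_
    obtain ⟨c, hc⟩ := minpoly.natDegree_eq_one_iff.1 h
    have hc1 : c = 1 := by rw [← htr c, hc, hat]
    simpa [hc1] using hc
  refine ⟨1 + k, hdeg, ?_⟩
  rw [← CharTwo.neg_eq (minpoly F (1 + k)).nextCoeff,
    ← Algebra.trace_eq_neg_nextCoeff_of_natDegree_eq_finrank (hdeg.trans hE.symm), hat]

/-- In characteristic two, two roots of an irreducible quintic with `X⁴`-coefficient one do not
sum to one. -/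
theorem add_ne_one_of_aeval_eq_zero {F K : Type*} [Field F] [CharP F 2] [Field K] [Algebra F K]
    {g : F[X]} (hm : g.Monic) (hg : Irreducible g) (hdeg : g.natDegree = 5)
    (hn : g.coeff 4 = 1) {x y : K} (hx : aeval x g = 0) (hy : aeval y g = 0) :
    x + y ≠ 1 := by
  intro hxy
  have h2F := CharTwo.two_eq_zero (R := F)
  have h2 : (2 : K) = 0 := by
    simpa only [map_ofNat, map_zero] using congrArg (algebraMap F K) h2F
  have hy' : y = x + 1 := by linear_combination hxy - x * h2
  have hdvd : g ∣ g.comp (X + C 1) := by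
    rw [minpoly.eq_of_irreducible_of_monic hg hx hm]
    apply minpoly.dvd
    rw [← minpoly.eq_of_irreducible_of_monic hg hx hm, aeval_comp]
    simpa [← hy'] using hy
  have heq : g.comp (X + C 1) = g :=
    eq_of_monic_of_dvd_of_natDegree_le hm (hm.comp_X_add_C 1) hdvd
      (by rw [natDegree_comp, natDegree_X_add_C, mul_one])
  have h4 := congrArg (coeff · 4) heq
  have h5 : g.coeff 5 = 1 := hdeg ▸ hm.coeff_natDegree
  rw [← taylor_apply, taylor_coeff, hasseDeriv_apply, sum_over_range _ (by simp), hdeg] at h4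
  simp [Finset.sum_range_succ, Nat.choose, hn, h5] at h4
  have : (1 : F) = 0 := by linear_combination h4 - 2 * h2F
  exact one_ne_zero this

/-- If three roots of a monic quintic with `X⁴`-coefficient one sum to zero, the two remaining
roots sum to one in characteristic two. -/
theorem exists_roots_add_eq_one_of_add_add_eq_zero {F K : Type*} [Field F] [CharP F 2] [Field K]
    [Algebra F K] [IsAlgClosed K] {g : F[X]} (hm : g.Monic) (hdeg : g.natDegree = 5)
    (hn : g.nextCoeff = 1) {α β γ : K} (hαβ : α ≠ β) (hαγ : α ≠ γ) (hβγ : β ≠ γ)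
    (hα : aeval α g = 0) (hβ : aeval β g = 0) (hγ : aeval γ g = 0) (h : α + β + γ = 0) :
    ∃ x y : K, aeval x g = 0 ∧ aeval y g = 0 ∧ x + y = 1 := by
  have : CharP K 2 := charP_of_injective_algebraMap (algebraMap F K).injective 2
  have hmem (x : K) : x ∈ g.aroots K ↔ aeval x g = 0 := by simp [hm.ne_zero]
  have hle : ({α, β, γ} : Multiset K) ≤ g.aroots K := by
    rw [Multiset.le_iff_subset (by simp [hαβ, hαγ, hβγ])]
    intro x hx
    rw [hmem]
    simp only [Multiset.insert_eq_cons, Multiset.mem_cons, Multiset.mem_singleton] at hx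
    rcases hx with rfl | rfl | rfl <;> assumption
  obtain ⟨t, ht⟩ := Multiset.le_iff_exists_add.1 hle
  have hsp := IsAlgClosed.splits (g.map (algebraMap F K))
  have hcard : (g.aroots K).card = 5 := by
    rw [aroots_def, ← hsp.natDegree_eq_card_roots, natDegree_map, hdeg]
  have hsum : (g.aroots K).sum = 1 := by
    have := hsp.nextCoeff_eq_neg_sum_roots_of_monic (hm.map _)
    rw [nextCoeff_map (algebraMap F K).injective, hn, map_one, CharTwo.neg_eq] at this
    exact this.symm
  obtain ⟨x, y, rfl⟩ := Multiset.card_eq_two.1 (show t.card = 2 by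
    simp only [ht, Multiset.card_add, Multiset.insert_eq_cons, Multiset.card_cons,
      Multiset.card_singleton] at hcard
    omega)
  refine ⟨x, y, (hmem x).1 (by simp [ht]), (hmem y).1 (by simp [ht]), ?_⟩
  rw [ht] at hsum
  simp only [Multiset.insert_eq_cons, Multiset.sum_add, Multiset.sum_cons,
    Multiset.sum_singleton] at hsum
  linear_combination hsum - h

/-- over the finite field `F` of order `2 ^ d`, there is a monic
irreducible quintic of the form `X⁵ + X⁴ + e₁X³ + e₂X² + e₃X + e₄` no three of whose
roots in an algebraic closure sum to zero. -/
theorem exists_irreducible_quintic_no_three_roots_sum_zero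
    (d : ℕ) (hd : 1 ≤ d) (F : Type*) [Field F] [Fintype F]
    (hF : Fintype.card F = 2 ^ d) :
    ∃ g : Polynomial F,
      (∃ e₁ e₂ e₃ e₄ : F,
        g = X ^ 5 + X ^ 4 + C e₁ * X ^ 3 + C e₂ * X ^ 2 + C e₃ * X + C e₄) ∧
      Irreducible g ∧
      ∀ α β γ : AlgebraicClosure F, α ≠ β → α ≠ γ → β ≠ γ →
        Polynomial.aeval α g = 0 → Polynomial.aeval β g = 0 → Polynomial.aeval γ g = 0 →
        α + β + γ ≠ 0 := by
  have : CharP F 2 := charP_of_card_eq_prime_pow hF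
  obtain ⟨a, hdeg, hn⟩ := exists_minpoly_natDegree_eq_five_nextCoeff_eq_one F
    (FiniteField.Extension F 2 5) (FiniteField.finrank_extension F 2 5)
  have hint : IsIntegral F a := Algebra.IsIntegral.isIntegral a
  have hm := minpoly.monic hint
  have h4 : (minpoly F a).coeff 4 = 1 := by
    rw [← hn, nextCoeff_of_natDegree_pos (by omega), hdeg]
  have h5 : (minpoly F a).coeff 5 = 1 := by
    rw [← hm.coeff_natDegree, hdeg]
  refine ⟨minpoly F a,
    ⟨(minpoly F a).coeff 3, (minpoly F a).coeff 2, (minpoly F a).coeff 1, (minpoly F a).coeff 0,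
      ?_⟩, minpoly.irreducible hint, ?_⟩
  · conv_lhs => rw [(minpoly F a).as_sum_range_C_mul_X_pow, hdeg]
    simp only [Finset.sum_range_succ, Finset.sum_range_zero, h4, h5, map_one]
    ring
  · intro α β γ hαβ hαγ hβγ hα hβ hγ h
    obtain ⟨x, y, hx, hy, hxy⟩ :=
      exists_roots_add_eq_one_of_add_add_eq_zero hm hdeg hn hαβ hαγ hβγ hα hβ hγ h
    exact add_ne_one_of_aeval_eq_zero hm (minpoly.irreducible hint) hdeg h4 hx hy hxy
end

section
/- The Fermat cubic polynomial f = x₀³ + x₁³ + x₂³ + x₃³ over ℚ defines a smooth cubic surface, and the set of lines on V(f) defined over ℚ has exactly 3 elements, namely the lines corresponding to the subspaces {x₀ + x₁ = 0, x₂ + x₃ = 0}, {x₀ + x₂ = 0, x₁ + x₃ = 0}, and {x₀ + x₃ = 0, x₁ + x₂ = 0}. -/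
open MvPolynomial

/-- The plane `{x : k⁴ | x i + x j = 0}`. -/
noncomputable def sumZeroPlane (i j : Fin 4) : Submodule ℚ (Fin 4 → ℚ) :=
  LinearMap.ker ((LinearMap.proj i : (Fin 4 → ℚ) →ₗ[ℚ] ℚ) + LinearMap.proj j)

/-- The Fermat cubic polynomial. -/
local notation "fermatCubic" => (X 0 ^ 3 + X 1 ^ 3 + X 2 ^ 3 + X 3 ^ 3 : MvPolynomial (Fin 4) ℚ)

theorem isSmoothCubic_fermat : IsSmoothCubic ℚ fermatCubic := by
  refine ⟨fun h => ?_, ?_, ?_⟩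
  · have := congrArg (eval fun _ => (1 : ℚ)) h
    norm_num at this
  · have hX (i : Fin 4) : (X i ^ 3 : MvPolynomial (Fin 4) ℚ).IsHomogeneous 3 := by
      simpa using (isHomogeneous_X ℚ i).pow 3
    exact (((hX 0).add (hX 1)).add (hX 2)).add (hX 3)
  · rintro x ⟨-, h⟩
    have h0 := h 0
    have h1 := h 1
    have h2 := h 2
    have h3 := h 3
    simp [pderiv_X] at h0 h1 h2 h3
    ext i
    fin_cases i <;> simpa

theorem lineRestrict_fermat (v w : Fin 4 → ℚ) :
    lineRestrict fermatCubic v w = ∑ m, (C (v m) * X 0 + C (w m) * X 1) ^ 3 := by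
  simp [lineRestrict, Fin.sum_univ_four]

theorem IsLineOn.sum_pow_three_eq_zero {W : Submodule ℚ (Fin 4 → ℚ)}
    (hW : IsLineOn fermatCubic W) {x : Fin 4 → ℚ} (hx : x ∈ W) : ∑ m, x m ^ 3 = 0 := by
  obtain ⟨-, v, w, rfl, h⟩ := hW
  obtain ⟨a, b, rfl⟩ := Submodule.mem_span_pair.1 hx
  rw [lineRestrict_fermat] at h
  simpa [mul_comm] using congrArg (eval ![a, b]) h

/-- A subspace of dimension at least two meets every coordinate hyperplane nontrivially. -/
theorem exists_ne_zero_mem_apply_eq_zero {k ι : Type*} [Field k] {W : Submodule k (ι → k)}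
    (hW : 1 < Module.finrank k W) (i : ι) : ∃ u ∈ W, u ≠ 0 ∧ u i = 0 := by
  have : FiniteDimensional k W := .of_finrank_pos (by omega)
  have hker : LinearMap.ker ((LinearMap.proj i : (ι → k) →ₗ[k] k) ∘ₗ W.subtype) ≠ ⊥ :=
    LinearMap.ker_ne_bot_of_finrank_lt (by simpa using hW)
  obtain ⟨u, hu, hu0⟩ := Submodule.exists_mem_ne_zero_of_ne_bot hker
  exact ⟨u, u.2, by simpa using hu0, by simpa using hu⟩

/-- The special case of exponent three of Fermat's last theorem, for rational numbers. -/
theorem Rat.eq_zero_of_pow_three_add_eq_zero {a b c : ℚ} (h : a ^ 3 + b ^ 3 + c ^ 3 = 0) :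
    a = 0 ∨ b = 0 ∨ c = 0 := by
  by_contra! hne
  refine fermatLastTheoremFor_iff_rat.1 fermatLastTheoremThree a b (-c) hne.1 hne.2.1
    (neg_ne_zero.2 hne.2.2) ?_
  linear_combination h

theorem Rat.add_eq_zero_of_pow_three_add_eq_zero {a b : ℚ} (h : a ^ 3 + b ^ 3 = 0) :
    a + b = 0 := by
  have : a ^ 3 = (-b) ^ 3 := by linear_combination h
  rw [(Odd.strictMono_pow (by decide)).injective this, neg_add_cancel]

theorem mem_sumZeroPlane {i j : Fin 4} {x : Fin 4 → ℚ} :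
    x ∈ sumZeroPlane i j ↔ x i + x j = 0 := by
  simp [sumZeroPlane]

theorem Equiv.Perm.sum_fin_four (σ : Equiv.Perm (Fin 4)) (g : Fin 4 → ℚ) :
    ∑ m, g m = g (σ 0) + g (σ 1) + g (σ 2) + g (σ 3) := by
  rw [← Equiv.sum_comp σ g, Fin.sum_univ_four]

theorem sumZeroPlane_inf_eq_span (σ : Equiv.Perm (Fin 4)) :
    Submodule.span ℚ {(Pi.single (σ 0) 1 - Pi.single (σ 1) 1 : Fin 4 → ℚ),
      Pi.single (σ 2) 1 - Pi.single (σ 3) 1} =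
      sumZeroPlane (σ 0) (σ 1) ⊓ sumZeroPlane (σ 2) (σ 3) := by
  ext x
  simp only [Submodule.mem_span_pair, Submodule.mem_inf, mem_sumZeroPlane]
  constructor
  · rintro ⟨a, b, rfl⟩
    simp
  · rintro ⟨h, h'⟩
    refine ⟨x (σ 0), x (σ 2), funext fun m => ?_⟩
    obtain ⟨m, rfl⟩ := σ.surjective m
    fin_cases m <;> simp <;> linarith

theorem finrank_sumZeroPlane_inf (σ : Equiv.Perm (Fin 4)) :
    Module.finrank ℚ ↥(sumZeroPlane (σ 0) (σ 1) ⊓ sumZeroPlane (σ 2) (σ 3)) = 2 := by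
  have hli : LinearIndependent ℚ ![(Pi.single (σ 0) 1 - Pi.single (σ 1) 1 : Fin 4 → ℚ),
      Pi.single (σ 2) 1 - Pi.single (σ 3) 1] := by
    refine LinearIndependent.pair_iff.2 fun a b h => ?_
    have h0 := congrFun h (σ 0)
    have h2 := congrFun h (σ 2)
    simp at h0 h2
    exact ⟨h0, h2⟩
  rw [← sumZeroPlane_inf_eq_span, ← Matrix.range_cons_cons_empty _ _ ![],
    finrank_span_eq_card hli, Fintype.card_fin]

theorem isLineOn_sumZeroPlane_inf (σ : Equiv.Perm (Fin 4)) :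
    IsLineOn fermatCubic (sumZeroPlane (σ 0) (σ 1) ⊓ sumZeroPlane (σ 2) (σ 3)) := by
  refine ⟨finrank_sumZeroPlane_inf σ, _, _, sumZeroPlane_inf_eq_span σ, ?_⟩
  rw [lineRestrict_fermat, ← Equiv.sum_comp σ, Fin.sum_univ_four]
  simp
  ring

/-- A rational line on the Fermat cubic is determined by one of its points with two vanishing
coordinates. -/
theorem IsLineOn.eq_sumZeroPlane_inf {W : Submodule ℚ (Fin 4 → ℚ)}
    (hW : IsLineOn fermatCubic W) (σ : Equiv.Perm (Fin 4)) {u : Fin 4 → ℚ} (hu : u ∈ W)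
    (hu0 : u ≠ 0) (h0 : u (σ 0) = 0) (h1 : u (σ 1) = 0) :
    W = sumZeroPlane (σ 0) (σ 1) ⊓ sumZeroPlane (σ 2) (σ 3) := by
  have hcube {x : Fin 4 → ℚ} (hx : x ∈ W) :
      x (σ 0) ^ 3 + x (σ 1) ^ 3 + x (σ 2) ^ 3 + x (σ 3) ^ 3 = 0 := by
    rw [← σ.sum_fin_four fun m => x m ^ 3, hW.sum_pow_three_eq_zero hx]
  have hu23 : u (σ 3) = -u (σ 2) := by
    have := hcube hu
    rw [h0, h1] at this
    linarith [Rat.add_eq_zero_of_pow_three_add_eq_zero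
      (show u (σ 2) ^ 3 + u (σ 3) ^ 3 = 0 by linear_combination this)]
  have hu2 : u (σ 2) ≠ 0 := by
    refine fun h2 => hu0 (funext fun m => ?_)
    obtain ⟨m, rfl⟩ := σ.surjective m
    fin_cases m <;> simp [*]
  refine Submodule.eq_of_le_of_finrank_eq (fun x hx => ?_)
    (hW.1.trans (finrank_sumZeroPlane_inf σ).symm)
  have hadd := hcube (W.add_mem hx hu)
  have hsub := hcube (W.sub_mem hx hu)
  have hx' := hcube hx
  simp only [Pi.add_apply, Pi.sub_apply, h0, h1, hu23] at hadd hsub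
  have h23 : x (σ 2) + x (σ 3) = 0 := by
    have : u (σ 2) ^ 2 * (x (σ 2) + x (σ 3)) = 0 := by
      linear_combination (hadd + hsub - 2 * hx') / 6
    simpa [hu2] using this
  refine Submodule.mem_inf.2 ⟨mem_sumZeroPlane.2 ?_, mem_sumZeroPlane.2 h23⟩
  refine Rat.add_eq_zero_of_pow_three_add_eq_zero ?_
  rw [eq_neg_of_add_eq_zero_left h23] at hx'
  linear_combination hx'

theorem isLineOn_fermat_iff (W : Submodule ℚ (Fin 4 → ℚ)) :
    IsLineOn fermatCubic W ↔
      (W = sumZeroPlane 0 1 ⊓ sumZeroPlane 2 3 ∨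
        W = sumZeroPlane 0 2 ⊓ sumZeroPlane 1 3 ∨
        W = sumZeroPlane 0 3 ⊓ sumZeroPlane 1 2) := by
  let σ : Equiv.Perm (Fin 4) := ⟨![0, 2, 1, 3], ![0, 2, 1, 3], by decide, by decide⟩
  let τ : Equiv.Perm (Fin 4) := ⟨![0, 3, 1, 2], ![0, 2, 3, 1], by decide, by decide⟩
  constructor
  · intro hW
    obtain ⟨u, hu, hu0, h0⟩ := exists_ne_zero_mem_apply_eq_zero (hW.1 ▸ one_lt_two) 0
    have hcube := hW.sum_pow_three_eq_zero hu
    rw [Fin.sum_univ_four, h0] at hcube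
    rcases Rat.eq_zero_of_pow_three_add_eq_zero
      (show u 1 ^ 3 + u 2 ^ 3 + u 3 ^ 3 = 0 by linear_combination hcube) with h | h | h
    · exact .inl (hW.eq_sumZeroPlane_inf 1 hu hu0 h0 h)
    · exact .inr (.inl (hW.eq_sumZeroPlane_inf σ hu hu0 h0 h))
    · exact .inr (.inr (hW.eq_sumZeroPlane_inf τ hu hu0 h0 h))
  · rintro (rfl | rfl | rfl)
    · exact isLineOn_sumZeroPlane_inf 1
    · exact isLineOn_sumZeroPlane_inf σ
    · exact isLineOn_sumZeroPlane_inf τ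

/-- the Fermat cubic over ℚ is smooth and has exactly the three rational
lines `{x₀+x₁=0, x₂+x₃=0}`, `{x₀+x₂=0, x₁+x₃=0}`, `{x₀+x₃=0, x₁+x₂=0}`. -/
theorem fermat_cubic_three_rational_lines :
    IsSmoothCubic ℚ (X 0 ^ 3 + X 1 ^ 3 + X 2 ^ 3 + X 3 ^ 3 : MvPolynomial (Fin 4) ℚ) ∧
    (∀ W : Submodule ℚ (Fin 4 → ℚ),
      IsLineOn (X 0 ^ 3 + X 1 ^ 3 + X 2 ^ 3 + X 3 ^ 3 : MvPolynomial (Fin 4) ℚ) W ↔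
        (W = sumZeroPlane 0 1 ⊓ sumZeroPlane 2 3 ∨
          W = sumZeroPlane 0 2 ⊓ sumZeroPlane 1 3 ∨
          W = sumZeroPlane 0 3 ⊓ sumZeroPlane 1 2)) ∧
    sumZeroPlane 0 1 ⊓ sumZeroPlane 2 3 ≠ sumZeroPlane 0 2 ⊓ sumZeroPlane 1 3 ∧
    sumZeroPlane 0 1 ⊓ sumZeroPlane 2 3 ≠ sumZeroPlane 0 3 ⊓ sumZeroPlane 1 2 ∧
    sumZeroPlane 0 2 ⊓ sumZeroPlane 1 3 ≠ sumZeroPlane 0 3 ⊓ sumZeroPlane 1 2 := by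
  refine ⟨isSmoothCubic_fermat, isLineOn_fermat_iff, fun h => ?_, fun h => ?_, fun h => ?_⟩
  · have := (SetLike.ext_iff.1 h ![1, -1, 0, 0]).1
    simp [mem_sumZeroPlane] at this
  · have := (SetLike.ext_iff.1 h ![1, -1, 0, 0]).1
    simp [mem_sumZeroPlane] at this
  · have := (SetLike.ext_iff.1 h ![1, 0, -1, 0]).1
    simp [mem_sumZeroPlane] at this
end
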